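/- arXiv:1904.09782 — 3 statements merged into one kernel-verified Lean document; each statement's English description precedes it below -/
import Mathlib

section
/- If the coin process X satisfies the lower-tail condition (for any δ > 0 there exist K and m_0 such that Pr((1/m)log(1/P_{X^m}(X^m)) ≤ H_(X) − δ) ≤ K/m² for all m ≥ m_0) and H_(X) > 0, then for any target process Y the infimum average achievable rate of the interval algorithm satisfies L*_int(X,Y) ≤ H(Y)/H_(X), where H(Y) = limsup_{n→∞}(1/n)H(Y^n). -/
open MeasureTheory Filter
open scoped ENNReal Classical

noncomputable section

namespace RNG

variable {𝒳 𝒴 : Type*}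

/-- The length-`m` prefix of an infinite sequence, as a tuple. -/
def pre (ω : ℕ → 𝒳) (m : ℕ) : Fin m → 𝒳 := fun i => ω i

/-- The length-`m` prefix of an infinite sequence, as a list. -/
def preL (ω : ℕ → 𝒳) (m : ℕ) : List 𝒳 := (List.range m).map ω

/-- `P_{X^m}(x^m)` : the probability of the cylinder set of a finite string `x^m`,
for a process with law `μ`. -/
def cylP [MeasurableSpace 𝒳] (μ : Measure (ℕ → 𝒳)) {m : ℕ} (x : Fin m → 𝒳) : ℝ :=
  (μ {ω | ∀ i : Fin m, ω i = x i}).toReal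

/-- Validity (exact generation) of an algorithm `φ` (given as a full-tree function on finite
coin strings, `none` playing the role of `⊥`): for every target value `y`, the probability
that the algorithm terminates with output `y` equals `PY y`. -/
def Valid {B : Type*} [MeasurableSpace 𝒳] (μ : Measure (ℕ → 𝒳)) (PY : B → ℝ)
    (φ : List 𝒳 → Option B) : Prop :=
  ∀ y : B,
    (μ {ω | ∃ i : ℕ, φ (preL ω i) = some y ∧ ∀ j < i, φ (preL ω j) = none}).toReal = PY y

/-- Strict lexicographic order on strings. -/
def lexLt [LT 𝒳] {m : ℕ} (x' x : Fin m → 𝒳) : Prop :=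
  ∃ i : Fin m, (∀ j : Fin m, j < i → x' j = x j) ∧ x' i < x i

/-- The subinterval of `[0,1)` assigned to the string `x` by the interval algorithm:
strings are arranged in lexicographic order, `x` receiving an interval of length `P x`. -/
def itv [LT 𝒳] [Fintype 𝒳] {m : ℕ} (P : (Fin m → 𝒳) → ℝ) (x : Fin m → 𝒳) : Set ℝ :=
  Set.Ico (∑ x' ∈ Finset.univ.filter (fun x' => lexLt x' x), P x')
    ((∑ x' ∈ Finset.univ.filter (fun x' => lexLt x' x), P x') + P x)

/-- The interval algorithm generating `Y^n` (target law `ν`) from the coin process `μ`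
has stopped after at most `m` coin symbols on the sample `ω`, i.e. the coin interval
`I_{x^m}` is contained in some target interval `J_{y^n}`. -/
def IntStopped [LinearOrder 𝒳] [Fintype 𝒳] [LinearOrder 𝒴] [Fintype 𝒴]
    [MeasurableSpace 𝒳] [MeasurableSpace 𝒴]
    (μ : Measure (ℕ → 𝒳)) (ν : Measure (ℕ → 𝒴)) (n m : ℕ) (ω : ℕ → 𝒳) : Prop :=
  ∃ y : Fin n → 𝒴, itv (fun x : Fin m → 𝒳 => cylP μ x) (pre ω m)
      ⊆ itv (fun y' : Fin n → 𝒴 => cylP ν y') y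

/-- A rate `R` is achievable by the interval algorithm:
`Pr(T_n > nR) → 0` (the stopping time `T_n` is `ℕ`-valued, so `T_n > nR ↔ T_n > ⌊nR⌋`). -/
def IntAchievable [LinearOrder 𝒳] [Fintype 𝒳] [LinearOrder 𝒴] [Fintype 𝒴]
    [MeasurableSpace 𝒳] [MeasurableSpace 𝒴]
    (μ : Measure (ℕ → 𝒳)) (ν : Measure (ℕ → 𝒴)) (R : ℝ) : Prop :=
  0 ≤ R ∧ Tendsto (fun n : ℕ =>
      (μ {ω | ¬ IntStopped μ ν n ⌊(n : ℝ) * R⌋₊ ω}).toReal) atTop (nhds 0)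

/-- `R⋆_int(X,Y)` : the infimum rate achievable by the interval algorithm. -/
def Rint [LinearOrder 𝒳] [Fintype 𝒳] [LinearOrder 𝒴] [Fintype 𝒴]
    [MeasurableSpace 𝒳] [MeasurableSpace 𝒴]
    (μ : Measure (ℕ → 𝒳)) (ν : Measure (ℕ → 𝒴)) : ℝ :=
  sInf {R : ℝ | IntAchievable μ ν R}

/-- A rate `R` is achievable by some sequence of valid algorithms: for each `n` there is a
valid algorithm `φ n` generating `Y^n` and `Pr(T_n > nR) → 0`. -/
def Achievable [MeasurableSpace 𝒳] [MeasurableSpace 𝒴]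
    (μ : Measure (ℕ → 𝒳)) (ν : Measure (ℕ → 𝒴)) (R : ℝ) : Prop :=
  0 ≤ R ∧ ∃ φ : (n : ℕ) → List 𝒳 → Option (Fin n → 𝒴),
    (∀ n : ℕ, Valid μ (fun y : Fin n → 𝒴 => cylP ν y) (φ n)) ∧
    Tendsto (fun n : ℕ =>
      (μ {ω | ∀ i ≤ ⌊(n : ℝ) * R⌋₊, φ n (preL ω i) = none}).toReal) atTop (nhds 0)

/-- `R⋆(X,Y)` : the infimum rate achievable over all valid algorithms. -/
def Rstar [MeasurableSpace 𝒳] [MeasurableSpace 𝒴]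
    (μ : Measure (ℕ → 𝒳)) (ν : Measure (ℕ → 𝒴)) : ℝ :=
  sInf {R : ℝ | Achievable μ ν R}

/-- The expected stopping time `E[T_n]` of the interval algorithm, via `E[T] = ∑_m Pr(T>m)`. -/
def intAvgT [LinearOrder 𝒳] [Fintype 𝒳] [LinearOrder 𝒴] [Fintype 𝒴]
    [MeasurableSpace 𝒳] [MeasurableSpace 𝒴]
    (μ : Measure (ℕ → 𝒳)) (ν : Measure (ℕ → 𝒴)) (n : ℕ) : ℝ≥0∞ :=
  ∑' m : ℕ, μ {ω | ¬ IntStopped μ ν n m ω}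

/-- A rate `L` is average achievable by the interval algorithm: `limsup E[T_n]/n ≤ L`. -/
def IntAvgAchievable [LinearOrder 𝒳] [Fintype 𝒳] [LinearOrder 𝒴] [Fintype 𝒴]
    [MeasurableSpace 𝒳] [MeasurableSpace 𝒴]
    (μ : Measure (ℕ → 𝒳)) (ν : Measure (ℕ → 𝒴)) (L : ℝ≥0∞) : Prop :=
  limsup (fun n : ℕ => intAvgT μ ν n / (n : ℝ≥0∞)) atTop ≤ L

/-- `L⋆_int(X,Y)` : the infimum average achievable rate of the interval algorithm. -/
def Lint [LinearOrder 𝒳] [Fintype 𝒳] [LinearOrder 𝒴] [Fintype 𝒴]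
    [MeasurableSpace 𝒳] [MeasurableSpace 𝒴]
    (μ : Measure (ℕ → 𝒳)) (ν : Measure (ℕ → 𝒴)) : ℝ≥0∞ :=
  sInf {L : ℝ≥0∞ | IntAvgAchievable μ ν L}

/-- A rate `L` is average achievable by some sequence of valid algorithms. -/
def AvgAchievable [MeasurableSpace 𝒳] [MeasurableSpace 𝒴]
    (μ : Measure (ℕ → 𝒳)) (ν : Measure (ℕ → 𝒴)) (L : ℝ≥0∞) : Prop :=
  ∃ φ : (n : ℕ) → List 𝒳 → Option (Fin n → 𝒴),
    (∀ n : ℕ, Valid μ (fun y : Fin n → 𝒴 => cylP ν y) (φ n)) ∧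
    limsup (fun n : ℕ =>
      (∑' m : ℕ, μ {ω | ∀ i ≤ m, φ n (preL ω i) = none}) / (n : ℝ≥0∞)) atTop ≤ L

/-- `L⋆(X,Y)` : the infimum average achievable rate over all valid algorithms. -/
def Lstar [MeasurableSpace 𝒳] [MeasurableSpace 𝒴]
    (μ : Measure (ℕ → 𝒳)) (ν : Measure (ℕ → 𝒴)) : ℝ≥0∞ :=
  sInf {L : ℝ≥0∞ | AvgAchievable μ ν L}

/-- The spectral sup-entropy `H̄(X)`: the event `(1/m) log(1/P_{X^m}(X^m)) ≥ λ` is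
`P_{X^m}(X^m) ≤ 2^{-mλ}`. -/
def specSup [MeasurableSpace 𝒳] (μ : Measure (ℕ → 𝒳)) : ℝ :=
  sInf {lam : ℝ | Tendsto (fun m : ℕ =>
    (μ {ω | cylP μ (pre ω m) ≤ (2 : ℝ) ^ (-((m : ℝ) * lam))}).toReal) atTop (nhds 0)}

/-- The spectral inf-entropy `H̲(X)`: the event `(1/m) log(1/P_{X^m}(X^m)) ≤ λ` is
`P_{X^m}(X^m) ≥ 2^{-mλ}`. -/
def specInf [MeasurableSpace 𝒳] (μ : Measure (ℕ → 𝒳)) : ℝ :=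
  sSup {lam : ℝ | Tendsto (fun m : ℕ =>
    (μ {ω | (2 : ℝ) ^ (-((m : ℝ) * lam)) ≤ cylP μ (pre ω m)}).toReal) atTop (nhds 0)}

/-- The (sup-)entropy rate `H(X) = limsup (1/m) H(X^m)`. -/
def entRate [MeasurableSpace 𝒳] [Fintype 𝒳] (μ : Measure (ℕ → 𝒳)) : ℝ :=
  limsup (fun m : ℕ =>
    (∑ x : Fin m → 𝒳, cylP μ x * Real.logb 2 (1 / cylP μ x)) / (m : ℝ)) atTop

/-- Upper-tail condition: `Pr((1/m) log(1/P_{X^m}(X^m)) ≥ H̄(X)+δ) ≤ K/m²` eventually. -/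
def UpperTail [MeasurableSpace 𝒳] (μ : Measure (ℕ → 𝒳)) : Prop :=
  ∀ δ : ℝ, 0 < δ → ∃ (K : ℝ) (m₀ : ℕ), ∀ m : ℕ, m₀ ≤ m →
    (μ {ω | cylP μ (pre ω m) ≤ (2 : ℝ) ^ (-((m : ℝ) * (specSup μ + δ)))}).toReal
      ≤ K / (m : ℝ) ^ 2

/-- Lower-tail condition: `Pr((1/m) log(1/P_{X^m}(X^m)) ≤ H̲(X)−δ) ≤ K/m²` eventually. -/
def LowerTail [MeasurableSpace 𝒳] (μ : Measure (ℕ → 𝒳)) : Prop :=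
  ∀ δ : ℝ, 0 < δ → ∃ (K : ℝ) (m₀ : ℕ), ∀ m : ℕ, m₀ ≤ m →
    (μ {ω | (2 : ℝ) ^ (-((m : ℝ) * (specInf μ - δ))) ≤ cylP μ (pre ω m)}).toReal
      ≤ K / (m : ℝ) ^ 2

/-- The finite-dimensional distributions of a Markov chain with initial distribution `q`
and transition matrix `W` (`W x x'` is the transition probability from `x` to `x'`). -/
def markovP (q : 𝒳 → ℝ) (W : 𝒳 → 𝒳 → ℝ) : (m : ℕ) → (Fin m → 𝒳) → ℝ
  | 0, _ => 1
  | m + 1, x => q (x 0) * ∏ i : Fin m, W (x i.castSucc) (x i.succ)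

/-- `μ` is the law of the Markov chain with initial distribution `q` and transition matrix `W`. -/
def IsMarkovMeasure [MeasurableSpace 𝒳] (μ : Measure (ℕ → 𝒳)) (q : 𝒳 → ℝ)
    (W : 𝒳 → 𝒳 → ℝ) : Prop :=
  ∀ (m : ℕ) (x : Fin m → 𝒳), cylP μ x = markovP q W m x

/-- `W` is a (row-)stochastic transition matrix. -/
def IsTransMat [Fintype 𝒳] (W : 𝒳 → 𝒳 → ℝ) : Prop :=
  (∀ x x', 0 ≤ W x x') ∧ ∀ x, ∑ x', W x x' = 1

/-- Irreducibility: any state reaches any other in some `k ≥ 1` steps. -/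
def IrreducibleMat [Fintype 𝒳] [DecidableEq 𝒳] (W : Matrix 𝒳 𝒳 ℝ) : Prop :=
  ∀ x x' : 𝒳, ∃ k : ℕ, 1 ≤ k ∧ 0 < (W ^ k) x x'

/-- `π` is a stationary distribution of `W`. -/
def IsStationary [Fintype 𝒳] (π : 𝒳 → ℝ) (W : 𝒳 → 𝒳 → ℝ) : Prop :=
  (∀ x, 0 ≤ π x) ∧ (∑ x, π x = 1) ∧ ∀ x, ∑ x', π x' * W x' x = π x

/-- `q` is a probability distribution (initial distribution). -/
def IsInitial [Fintype 𝒳] (q : 𝒳 → ℝ) : Prop :=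
  (∀ x, 0 ≤ q x) ∧ ∑ x, q x = 1

/-- The entropy rate `H^W(X) = Σ_{x',x} π(x') W(x|x') log (1/W(x|x'))` of a stationary
Markov chain. -/
def matEnt [Fintype 𝒳] (π : 𝒳 → ℝ) (W : 𝒳 → 𝒳 → ℝ) : ℝ :=
  ∑ x' : 𝒳, ∑ x : 𝒳, π x' * W x' x * Real.logb 2 (1 / W x' x)

/-- The weight `w(ξ) = Pr(Y_1 ∈ 𝒴_ξ)` of the irreducible class `ξ` under the initial
distribution `q`, where `c` assigns to each state its class. -/
def wgt [Fintype 𝒴] {r : ℕ} (c : 𝒴 → Fin r) (q : 𝒴 → ℝ) (ξ : Fin r) : ℝ :=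
  ∑ y ∈ Finset.univ.filter (fun y => c y = ξ), q y

/-- The binary entropy function (base 2). -/
def binEnt (t : ℝ) : ℝ := t * Real.logb 2 (1 / t) + (1 - t) * Real.logb 2 (1 / (1 - t))

end RNG

open RNG

namespace RNG

section Intervals

variable {𝒳 : Type*} [LinearOrder 𝒳] [Fintype 𝒳] {m : ℕ} {P : (Fin m → 𝒳) → ℝ}

lemma sum_lexLt_add_le (hP : ∀ x, 0 ≤ P x) {x z : Fin m → 𝒳} (h : lexLt x z) :
    (∑ x' ∈ Finset.univ.filter (fun x' => lexLt x' x), P x') + P x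
      ≤ ∑ x' ∈ Finset.univ.filter (fun x' => lexLt x' z), P x' := by
  have hx : x ∉ Finset.univ.filter (fun x' => lexLt x' x) := by
    simpa using fun h' : lexLt x x => lt_irrefl (toLex x) h'
  rw [add_comm, ← Finset.sum_insert hx]
  refine Finset.sum_le_sum_of_subset_of_nonneg (fun w hw => ?_) fun w _ _ => hP w
  simp only [Finset.mem_insert, Finset.mem_filter, Finset.mem_univ, true_and] at hw ⊢
  rcases hw with rfl | hw
  · exact h
  · exact lt_trans (a := toLex w) (b := toLex x) (c := toLex z) hw h

lemma itv_subset_Ico (hP : ∀ x, 0 ≤ P x) (h1 : ∑ x, P x = 1) (x : Fin m → 𝒳) :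
    itv P x ⊆ Set.Ico 0 1 := by
  have hx : x ∉ Finset.univ.filter (fun x' => lexLt x' x) := by
    simpa using fun h' : lexLt x x => lt_irrefl (toLex x) h'
  refine Set.Ico_subset_Ico (Finset.sum_nonneg fun w _ => hP w) ?_
  rw [add_comm, ← Finset.sum_insert hx, ← h1]
  exact Finset.sum_le_sum_of_subset_of_nonneg (Finset.subset_univ _) fun w _ _ => hP w

lemma pairwise_disjoint_itv (hP : ∀ x, 0 ≤ P x) : Pairwise (Function.onFun Disjoint (itv P)) := by
  intro x z hxz
  rw [Function.onFun, itv, itv, Set.Ico_disjoint_Ico]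
  rcases lt_trichotomy (toLex x) (toLex z) with h | h | h
  · exact (min_le_left _ _).trans ((sum_lexLt_add_le hP h).trans (le_max_right _ _))
  · exact absurd (toLex.injective h) hxz
  · exact (min_le_right _ _).trans ((sum_lexLt_add_le hP h).trans (le_max_left _ _))

end Intervals

/-- An interval shorter than `ε` that straddles an endpoint of `[c, d)` meets `[c, d)` in a set
of length at most `2ε`. -/
lemma Ico_inter_Ico_subset_of_not_subset {a b c d ε : ℝ} (hε : b - a < ε)
    (h : ¬ Set.Ico a b ⊆ Set.Ico c d) :
    Set.Ico a b ∩ Set.Ico c d ⊆ Set.Ico c (c + ε) ∪ Set.Ico (d - ε) d := by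
  rintro t ⟨⟨hat, htb⟩, hct, htd⟩
  by_cases hac : a < c
  · exact Or.inl ⟨hct, by linarith⟩
  · by_cases hbd : d < b
    · exact Or.inr ⟨by linarith, htd⟩
    · exact absurd (Set.Ico_subset_Ico (not_lt.1 hac) (not_lt.1 hbd)) h

/-- Given two interval partitions of `[0, 1)`, the total length of the intervals of the first
that are shorter than `ε` and not contained in any interval of the second. -/
lemma sum_length_not_subset_le {ι κ : Type*} [Fintype ι] [Fintype κ] {a P : ι → ℝ} {b Q : κ → ℝ}
    (hId : Pairwise (Function.onFun Disjoint fun i => Set.Ico (a i) (a i + P i)))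
    (hI : ∀ i, Set.Ico (a i) (a i + P i) ⊆ Set.Ico 0 1)
    (hJd : Pairwise (Function.onFun Disjoint fun k => Set.Ico (b k) (b k + Q k)))
    (hJ : ∀ k, Set.Ico (b k) (b k + Q k) ⊆ Set.Ico 0 1)
    (hQ : ∀ k, 0 ≤ Q k) (hQ1 : ∑ k, Q k = 1) {ε : ℝ} (hε : 0 ≤ ε) :
    ∑ i ∈ Finset.univ.filter (fun i => P i < ε ∧
        ∀ k, ¬ Set.Ico (a i) (a i + P i) ⊆ Set.Ico (b k) (b k + Q k)), ENNReal.ofReal (P i)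
      ≤ ∑ k, ENNReal.ofReal (min (Q k) (2 * ε)) := by
  set s := Finset.univ.filter (fun i => P i < ε ∧
        ∀ k, ¬ Set.Ico (a i) (a i + P i) ⊆ Set.Ico (b k) (b k + Q k)) with hs
  set A : Set ℝ := ⋃ i ∈ s, Set.Ico (a i) (a i + P i)
  set B : Set ℝ := ⋃ k ∈ (Finset.univ : Finset κ), Set.Ico (b k) (b k + Q k)
  have hA : ∑ i ∈ s, ENNReal.ofReal (P i) = volume A := by
    rw [measure_biUnion_finset (fun i _ j _ hij => hId hij) fun _ _ => measurableSet_Ico]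
    simp
  have hB : volume B = 1 := by
    rw [measure_biUnion_finset (fun i _ j _ hij => hJd hij) fun _ _ => measurableSet_Ico]
    simp [← ENNReal.ofReal_sum_of_nonneg fun k _ => hQ k, hQ1]
  have hBm : MeasurableSet B := Finset.measurableSet_biUnion _ fun _ _ => measurableSet_Ico
  have hBI : B ⊆ Set.Ico 0 1 := Set.iUnion₂_subset fun k _ => hJ k
  have hAI : A ⊆ Set.Ico 0 1 := Set.iUnion₂_subset fun i _ => hI i
  have hnull : volume (Set.Ico (0 : ℝ) 1 \ B) = 0 := by
    rw [measure_sdiff hBI hBm.nullMeasurableSet (by simp [hB]), hB]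
    simp
  have hk (k : κ) : volume (A ∩ Set.Ico (b k) (b k + Q k)) ≤ ENNReal.ofReal (min (Q k) (2 * ε)) := by
    rw [ENNReal.ofReal_min]
    refine le_min ((measure_mono Set.inter_subset_right).trans (by simp)) ?_
    have hsub : A ∩ Set.Ico (b k) (b k + Q k) ⊆
        Set.Ico (b k) (b k + ε) ∪ Set.Ico (b k + Q k - ε) (b k + Q k) := by
      rw [Set.iUnion₂_inter]
      refine Set.iUnion₂_subset fun i hi => ?_
      simp only [hs, Finset.mem_filter, Finset.mem_univ, true_and] at hi
      exact Ico_inter_Ico_subset_of_not_subset (by linarith [hi.1]) (hi.2 k)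
    refine (measure_mono hsub).trans ((measure_union_le _ _).trans ?_)
    simp [two_mul, ENNReal.ofReal_add hε hε]
  calc ∑ i ∈ s, ENNReal.ofReal (P i) = volume A := hA
    _ ≤ volume ((⋃ k ∈ (Finset.univ : Finset κ), A ∩ Set.Ico (b k) (b k + Q k)) ∪
        (Set.Ico 0 1 \ B)) := by
      refine measure_mono fun t ht => ?_
      by_cases htB : t ∈ B
      · left
        rw [← Set.inter_iUnion₂]
        exact ⟨ht, htB⟩
      · exact Or.inr ⟨hAI ht, htB⟩
    _ ≤ volume (⋃ k ∈ (Finset.univ : Finset κ), A ∩ Set.Ico (b k) (b k + Q k)) + 0 :=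
      (measure_union_le _ _).trans (by rw [hnull])
    _ ≤ ∑ k, ENNReal.ofReal (min (Q k) (2 * ε)) := by
      rw [add_zero]
      exact (measure_biUnion_finset_le _ _).trans (Finset.sum_le_sum fun k _ => hk k)

section Cylinders

variable {𝒳 : Type*} [MeasurableSpace 𝒳] (μ : Measure (ℕ → 𝒳))

lemma cylP_nonneg {m : ℕ} (x : Fin m → 𝒳) : 0 ≤ cylP μ x := ENNReal.toReal_nonneg

variable [IsProbabilityMeasure μ]

lemma cylP_le_one {m : ℕ} (x : Fin m → 𝒳) : cylP μ x ≤ 1 :=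
  ENNReal.toReal_mono ENNReal.one_ne_top prob_le_one

variable [Fintype 𝒳] [DiscreteMeasurableSpace 𝒳]

lemma measure_pre_mem {m : ℕ} (s : Finset (Fin m → 𝒳)) :
    μ {ω | pre ω m ∈ s} = ∑ x ∈ s, ENNReal.ofReal (cylP μ x) := by
  have hpre : Measurable fun ω : ℕ → 𝒳 => pre ω m :=
    measurable_pi_lambda _ fun i => measurable_pi_apply _
  have hmeas : ∀ x ∈ s, MeasurableSet ((fun ω : ℕ → 𝒳 => pre ω m) ⁻¹' {x}) :=
    fun x _ => hpre (measurableSet_singleton x)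
  refine (sum_measure_preimage_singleton s hmeas).symm.trans (Finset.sum_congr rfl fun x _ => ?_)
  rw [cylP, ENNReal.ofReal_toReal (measure_ne_top _ _)]
  congr 1
  ext ω
  simp [pre, funext_iff]

lemma sum_cylP (m : ℕ) : ∑ x : Fin m → 𝒳, cylP μ x = 1 := by
  have h := measure_pre_mem μ (Finset.univ : Finset (Fin m → 𝒳))
  rw [← ENNReal.ofReal_sum_of_nonneg fun x _ => cylP_nonneg μ x] at h
  simpa using h.symm

end Cylinders

/-- Summing the truncations of `q` at the geometric levels `2 · 2^{-ma}` costs at most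
`q log(1/q) / a` up to a constant multiple of `q`. -/
lemma tsum_min_le {a q : ℝ} (ha : 0 < a) (hq0 : 0 ≤ q) (hq1 : q ≤ 1) :
    ∑' m : ℕ, ENNReal.ofReal (min q (2 * (2 : ℝ) ^ (-((m : ℝ) * a))))
      ≤ ENNReal.ofReal (q * Real.logb 2 (1 / q) / a +
        (1 + 2 * (1 - (2 : ℝ) ^ (-a))⁻¹) * q) := by
  rcases hq0.eq_or_lt with rfl | hq
  · have (m : ℕ) : min 0 (2 * (2 : ℝ) ^ (-((m : ℝ) * a))) = 0 := min_eq_left (by positivity)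
    simp [this]
  set r : ℝ := (2 : ℝ) ^ (-a) with hr
  have hr0 : 0 < r := by positivity
  have hr1 : r < 1 := Real.rpow_lt_one_of_one_lt_of_neg (by norm_num) (by linarith)
  have hpow (m : ℕ) : (2 : ℝ) ^ (-((m : ℝ) * a)) = r ^ m := by
    rw [hr, ← Real.rpow_mul_natCast (by norm_num)]
    ring_nf
  simp only [hpow]
  have hL : 0 ≤ Real.logb 2 (1 / q) / a :=
    div_nonneg (Real.logb_nonneg (by norm_num) (by rw [le_div_iff₀ hq]; linarith)) ha.le
  set N := ⌈Real.logb 2 (1 / q) / a⌉₊ with hN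
  have hN1 : (N : ℝ) ≤ Real.logb 2 (1 / q) / a + 1 := (Nat.ceil_lt_add_one hL).le
  have hNq : r ^ N ≤ q := by
    rw [← hpow]
    have h1 : Real.logb 2 (1 / q) ≤ N * a := (div_le_iff₀ ha).1 (Nat.le_ceil _)
    rw [one_div, Real.logb_inv] at h1
    calc (2 : ℝ) ^ (-((N : ℝ) * a)) ≤ 2 ^ Real.logb 2 q :=
          Real.rpow_le_rpow_of_exponent_le (by norm_num) (by linarith)
      _ = q := Real.rpow_logb (by norm_num) (by norm_num) hq
  have hgeo : Summable fun m : ℕ => 2 * r ^ m :=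
    (summable_geometric_of_lt_one hr0.le hr1).mul_left 2
  have hnn (m : ℕ) : 0 ≤ min q (2 * r ^ m) := by positivity
  have hsum : Summable fun m : ℕ => min q (2 * r ^ m) :=
    hgeo.of_nonneg_of_le hnn fun m => min_le_right _ _
  rw [← ENNReal.ofReal_tsum_of_nonneg hnn hsum]
  refine ENNReal.ofReal_le_ofReal ?_
  rw [← hsum.sum_add_tsum_nat_add N]
  have h1 : ∑ m ∈ Finset.range N, min q (2 * r ^ m) ≤ N * q :=
    (Finset.sum_le_sum fun m _ => min_le_left _ _).trans (by simp)
  have h2 : ∑' m : ℕ, min q (2 * r ^ (m + N)) ≤ 2 * q * (1 - r)⁻¹ := by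
    rw [← tsum_geometric_of_lt_one hr0.le hr1, ← tsum_mul_left]
    refine ((summable_nat_add_iff N).2 hsum).tsum_le_tsum (fun m => ?_)
      ((summable_geometric_of_lt_one hr0.le hr1).mul_left _)
    refine (min_le_right _ _).trans ?_
    rw [pow_add]
    nlinarith [mul_le_mul_of_nonneg_left hNq (pow_pos hr0 m).le]
  have h3 : (N : ℝ) * q ≤ (Real.logb 2 (1 / q) / a + 1) * q := by gcongr
  calc _ ≤ N * q + 2 * q * (1 - r)⁻¹ := add_le_add h1 h2
    _ ≤ (Real.logb 2 (1 / q) / a + 1) * q + 2 * q * (1 - r)⁻¹ := by gcongr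
    _ = _ := by ring

/-- The Shannon entropy (base 2) of a probability vector is at most the logarithm of its size. -/
lemma sum_mul_logb_one_div_le {κ : Type*} [Fintype κ] {q : κ → ℝ} (hq : ∀ k, 0 ≤ q k)
    (hq1 : ∑ k, q k = 1) : ∑ k, q k * Real.logb 2 (1 / q k) ≤ Real.logb 2 (Fintype.card κ) := by
  have : Nonempty κ := by
    by_contra h
    rw [not_nonempty_iff] at h
    simp at hq1
  have hc : (0 : ℝ) < Fintype.card κ := by exact_mod_cast Fintype.card_pos
  have h2 : (0 : ℝ) < Real.log 2 := Real.log_pos (by norm_num)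
  have hk (k : κ) : q k * Real.log (1 / q k) ≤
      q k * Real.log (Fintype.card κ) + ((Fintype.card κ : ℝ)⁻¹ - q k) := by
    rcases (hq k).eq_or_lt with h | h
    · simp [← h]
    have hl := Real.log_le_sub_one_of_pos (x := (q k * Fintype.card κ)⁻¹) (by positivity)
    rw [Real.log_inv, Real.log_mul h.ne' hc.ne'] at hl
    have := mul_le_mul_of_nonneg_left hl h.le
    have he : q k * ((q k * Fintype.card κ)⁻¹ - 1) = (Fintype.card κ : ℝ)⁻¹ - q k := by
      field_simp
    rw [one_div, Real.log_inv]
    linarith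
  have hs := Finset.sum_le_sum fun k (_ : k ∈ Finset.univ) => hk k
  rw [Finset.sum_add_distrib, ← Finset.sum_mul, Finset.sum_sub_distrib, hq1] at hs
  simp only [Real.logb, ← mul_div_assoc, ← Finset.sum_div]
  gcongr
  simpa [mul_inv_cancel₀ hc.ne'] using hs

lemma sum_mul_logb_one_div_nonneg {κ : Type*} [Fintype κ] {q : κ → ℝ} (hq : ∀ k, 0 ≤ q k)
    (hq1 : ∀ k, q k ≤ 1) : 0 ≤ ∑ k, q k * Real.logb 2 (1 / q k) := by
  refine Finset.sum_nonneg fun k _ => ?_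
  rcases (hq k).eq_or_lt with h | h
  · simp [← h]
  · exact mul_nonneg h.le (Real.logb_nonneg (by norm_num) (by rw [le_div_iff₀ h]; linarith [hq1 k]))

lemma tsum_measure_ne_top_of_lowerTail {𝒳 : Type*} [MeasurableSpace 𝒳]
    (μ : Measure (ℕ → 𝒳)) [IsProbabilityMeasure μ] (hLT : LowerTail μ) {δ : ℝ} (hδ : 0 < δ) :
    ∑' m : ℕ, μ {ω | (2 : ℝ) ^ (-((m : ℝ) * (specInf μ - δ))) ≤ cylP μ (pre ω m)} ≠ ∞ := by
  obtain ⟨K, m₀, hK⟩ := hLT δ hδ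
  have hs : Summable fun m : ℕ => (μ {ω | (2 : ℝ) ^ (-((m : ℝ) * (specInf μ - δ))) ≤
      cylP μ (pre ω m)}).toReal := by
    have hb : Summable fun m : ℕ => K / (m : ℝ) ^ 2 := by
      simpa [div_eq_mul_inv] using
        (Real.summable_one_div_nat_pow.2 one_lt_two).mul_left K
    refine hb.of_norm_bounded_eventually_nat ?_
    filter_upwards [eventually_ge_atTop m₀] with m hm
    rw [Real.norm_of_nonneg ENNReal.toReal_nonneg]
    exact hK m hm
  have := hs.tsum_ofReal_ne_top
  simpa [ENNReal.ofReal_toReal, measure_ne_top] using this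

lemma eventually_entropy_lt {𝒴 : Type*} [Fintype 𝒴] [MeasurableSpace 𝒴]
    [DiscreteMeasurableSpace 𝒴] (ν : Measure (ℕ → 𝒴)) [IsProbabilityMeasure ν] {E : ℝ} (hE : entRate ν < E) :
    ∀ᶠ n : ℕ in atTop,
      (∑ y : Fin n → 𝒴, cylP ν y * Real.logb 2 (1 / cylP ν y)) / (n : ℝ) < E := by
  refine eventually_lt_of_limsup_lt hE
    (isBoundedUnder_of ⟨Real.logb 2 (Fintype.card 𝒴), fun n => ?_⟩)
  have h := sum_mul_logb_one_div_le (cylP_nonneg ν (m := n)) (sum_cylP ν n)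
  rw [Fintype.card_fun, Fintype.card_fin, Nat.cast_pow, Real.logb_pow] at h
  rcases n.eq_zero_or_pos with rfl | hn
  · have : Nonempty (ℕ → 𝒴) := nonempty_of_isProbabilityMeasure ν
    have : Nonempty 𝒴 := this.map fun ω => ω 0
    simpa using Real.logb_nonneg one_lt_two
      (show (1 : ℝ) ≤ Fintype.card 𝒴 by exact_mod_cast Fintype.card_pos)
  · have : (0 : ℝ) < n := by exact_mod_cast hn
    exact (div_le_iff₀ this).2 (by linarith)

section Algorithm

variable {𝒳 𝒴 : Type*} [Fintype 𝒳] [LinearOrder 𝒳] [MeasurableSpace 𝒳]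
  [DiscreteMeasurableSpace 𝒳] [Fintype 𝒴] [LinearOrder 𝒴] [MeasurableSpace 𝒴]
  [DiscreteMeasurableSpace 𝒴]
  (μ : Measure (ℕ → 𝒳)) [IsProbabilityMeasure μ] (ν : Measure (ℕ → 𝒴)) [IsProbabilityMeasure ν]

lemma measure_not_intStopped_le (n m : ℕ) {ε : ℝ} (hε : 0 ≤ ε) :
    μ {ω | ¬ IntStopped μ ν n m ω} ≤ μ {ω | ε ≤ cylP μ (pre ω m)} +
      ∑ y : Fin n → 𝒴, ENNReal.ofReal (min (cylP ν y) (2 * ε)) := by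
  have hsub : {ω | ¬ IntStopped μ ν n m ω} ⊆ {ω | ε ≤ cylP μ (pre ω m)} ∪
      {ω | pre ω m ∈ Finset.univ.filter fun x : Fin m → 𝒳 => cylP μ x < ε ∧
        ∀ y : Fin n → 𝒴, ¬ itv (fun x : Fin m → 𝒳 => cylP μ x) x
          ⊆ itv (fun y' : Fin n → 𝒴 => cylP ν y') y} := by
    intro ω hω
    rcases le_or_gt ε (cylP μ (pre ω m)) with h | h
    · exact Or.inl h
    · exact Or.inr (Finset.mem_filter.2 ⟨Finset.mem_univ _, h, not_exists.1 hω⟩)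
  refine (measure_mono hsub).trans ((measure_union_le _ _).trans ?_)
  gcongr
  rw [measure_pre_mem]
  exact sum_length_not_subset_le
    (pairwise_disjoint_itv (cylP_nonneg μ)) (itv_subset_Ico (cylP_nonneg μ) (sum_cylP μ m))
    (pairwise_disjoint_itv (cylP_nonneg ν)) (itv_subset_Ico (cylP_nonneg ν) (sum_cylP ν n))
    (cylP_nonneg ν) (sum_cylP ν n) hε

lemma intAvgT_le (n : ℕ) {a : ℝ} (ha : 0 < a) :
    intAvgT μ ν n ≤ (∑' m : ℕ, μ {ω | (2 : ℝ) ^ (-((m : ℝ) * a)) ≤ cylP μ (pre ω m)}) +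
      ENNReal.ofReal ((∑ y : Fin n → 𝒴, cylP ν y * Real.logb 2 (1 / cylP ν y)) / a +
        (1 + 2 * (1 - (2 : ℝ) ^ (-a))⁻¹)) := by
  have hr1 : (2 : ℝ) ^ (-a) < 1 := Real.rpow_lt_one_of_one_lt_of_neg (by norm_num) (by linarith)
  have hC : 0 ≤ 1 + 2 * (1 - (2 : ℝ) ^ (-a))⁻¹ := by
    have := inv_nonneg.2 (sub_nonneg.2 hr1.le)
    linarith
  refine (ENNReal.tsum_le_tsum fun m =>
    measure_not_intStopped_le μ ν n m (Real.rpow_nonneg zero_le_two (-((m : ℝ) * a)))).trans ?_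
  rw [ENNReal.tsum_add]
  gcongr
  rw [Summable.tsum_finsetSum fun _ _ => ENNReal.summable]
  refine (Finset.sum_le_sum fun y _ =>
    tsum_min_le ha (cylP_nonneg ν y) (cylP_le_one ν y)).trans ?_
  rw [← ENNReal.ofReal_sum_of_nonneg]
  · rw [Finset.sum_add_distrib, ← Finset.mul_sum, sum_cylP, mul_one, Finset.sum_div]
  · intro y _
    have := sum_mul_logb_one_div_nonneg (κ := Unit) (q := fun _ => cylP ν y)
      (fun _ => cylP_nonneg ν y) (fun _ => cylP_le_one ν y)
    simp only [Finset.univ_unique, Finset.sum_singleton] at this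
    exact add_nonneg (div_nonneg this ha.le) (mul_nonneg hC (cylP_nonneg ν y))

lemma Lint_le_of_lt (hLT : LowerTail μ) {ε : ℝ} (hε : 0 < ε) (hεX : ε < specInf μ) :
    Lint μ ν ≤ ENNReal.ofReal ((entRate ν + ε) / (specInf μ - ε) + ε) := by
  have ha : 0 < specInf μ - ε := sub_pos.2 hεX
  set a := specInf μ - ε
  set S := ∑' m : ℕ, μ {ω | (2 : ℝ) ^ (-((m : ℝ) * a)) ≤ cylP μ (pre ω m)}
  have hS : S ≠ ∞ := tsum_measure_ne_top_of_lowerTail μ hLT hε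
  set C := 1 + 2 * (1 - (2 : ℝ) ^ (-a))⁻¹
  have hsmall : ∀ᶠ n : ℕ in atTop, (S.toReal + C) / (n : ℝ) < ε :=
    (tendsto_const_div_atTop_nhds_zero_nat _).eventually_lt_const hε
  refine sInf_le ?_
  rw [Set.mem_ofPred_eq, IntAvgAchievable]
  refine limsup_le_of_le (h := ?_)
  filter_upwards [hsmall, eventually_entropy_lt ν (lt_add_of_pos_right (entRate ν) hε),
    eventually_gt_atTop 0] with n h1 h2 hn
  have hn' : (0 : ℝ) < n := by exact_mod_cast hn
  have hC : 0 ≤ C := by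
    have := inv_nonneg.2 (sub_nonneg.2
      (Real.rpow_lt_one_of_one_lt_of_neg one_lt_two (neg_lt_zero.2 ha)).le)
    simp only [C]
    linarith
  have hH := sum_mul_logb_one_div_nonneg (cylP_nonneg ν (m := n)) (cylP_le_one ν)
  set H := ∑ y : Fin n → 𝒴, cylP ν y * Real.logb 2 (1 / cylP ν y)
  rw [← ENNReal.ofReal_natCast]
  calc intAvgT μ ν n / ENNReal.ofReal n
      ≤ ENNReal.ofReal (S.toReal + (H / a + C)) / ENNReal.ofReal n := by
        gcongr
        rw [ENNReal.ofReal_add ENNReal.toReal_nonneg (by positivity), ENNReal.ofReal_toReal hS]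
        exact intAvgT_le μ ν n ha
    _ = ENNReal.ofReal ((S.toReal + (H / a + C)) / n) := (ENNReal.ofReal_div_of_pos hn').symm
    _ ≤ ENNReal.ofReal ((entRate ν + ε) / a + ε) := by
        refine ENNReal.ofReal_le_ofReal ?_
        calc (S.toReal + (H / a + C)) / n = H / n / a + (S.toReal + C) / n := by
              field_simp
              ring
          _ ≤ (entRate ν + ε) / a + ε := by gcongr

end Algorithm

end RNG

/-- **Theorem 4, achievability part.** If the coin process `μ` satisfies the lower-tail
condition and `H̲(X) > 0`, then for any target process `ν` the infimum average achievable
rate of the interval algorithm satisfies `L⋆_int(X,Y) ≤ H(Y)/H̲(X)`. -/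
theorem Lint_le_ratio
    {𝒳 𝒴 : Type*} [Fintype 𝒳] [LinearOrder 𝒳] [MeasurableSpace 𝒳] [DiscreteMeasurableSpace 𝒳]
    [Fintype 𝒴] [LinearOrder 𝒴] [MeasurableSpace 𝒴] [DiscreteMeasurableSpace 𝒴]
    (μ : Measure (ℕ → 𝒳)) [IsProbabilityMeasure μ]
    (ν : Measure (ℕ → 𝒴)) [IsProbabilityMeasure ν]
    (hLT : LowerTail μ) (hX : 0 < specInf μ) :
    Lint μ ν ≤ ENNReal.ofReal (entRate ν / specInf μ) := by
  have hlim : Tendsto (fun ε : ℝ => ENNReal.ofReal ((entRate ν + ε) / (specInf μ - ε) + ε))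
      (nhdsWithin 0 (Set.Ioi 0)) (nhds (ENNReal.ofReal (entRate ν / specInf μ))) := by
    have hc : ContinuousAt (fun ε : ℝ => (entRate ν + ε) / (specInf μ - ε) + ε) 0 := by
      refine ContinuousAt.add (ContinuousAt.div ?_ ?_ ?_) ?_
      · fun_prop
      · fun_prop
      · simpa using hX.ne'
      · fun_prop
    have h := ENNReal.tendsto_ofReal hc.tendsto
    simp only [add_zero, sub_zero] at h
    exact h.mono_left nhdsWithin_le_nhds
  refine ge_of_tendsto hlim ?_
  filter_upwards [Ioo_mem_nhdsGT hX] with ε hε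
  exact Lint_le_of_lt μ ν hLT hε.1 hε.2
end
end

section
/- If the coin process X satisfies the upper-tail condition (for any δ > 0 there exist K and m_0 such that Pr((1/m)log(1/P_{X^m}(X^m)) ≥ H̄(X) + δ) ≤ K/m² for all m ≥ m_0), then for any target process Y the infimum average achievable rate over all valid random number generation algorithms satisfies L*(X,Y) ≥ H(Y)/H̄(X), where H(Y) = limsup_{n→∞}(1/n)H(Y^n). -/
open MeasureTheory Filter
open scoped ENNReal Classical

noncomputable section

namespace RNG

/-- The cylinder set of the strings with prefix `x`. -/
def cyl {𝒳 : Type*} {m : ℕ} (x : Fin m → 𝒳) : Set (ℕ → 𝒳) := {ω | ∀ i : Fin m, ω i = x i}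

/-- The event that `φ` stops after exactly `m` symbols with output `y`. -/
def stopAt {𝒳 B : Type*} (φ : List 𝒳 → Option B) (m : ℕ) (y : B) : Set (ℕ → 𝒳) :=
  {ω | φ (preL ω m) = some y ∧ ∀ j < m, φ (preL ω j) = none}

/-- The event that the ideal code length of the first `m` symbols is at least `m * lam`. -/
def atypical {𝒳 : Type*} [MeasurableSpace 𝒳] (μ : Measure (ℕ → 𝒳)) (lam : ℝ) (m : ℕ) :
    Set (ℕ → 𝒳) :=
  {ω | cylP μ (pre ω m) ≤ (2 : ℝ) ^ (-((m : ℝ) * lam))}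

lemma preL_eq_ofFn {𝒳 : Type*} (ω : ℕ → 𝒳) (m : ℕ) : preL ω m = List.ofFn (pre ω m) := by
  apply List.ext_getElem <;> simp [preL, pre]

lemma preL_congr {𝒳 : Type*} {ω ω' : ℕ → 𝒳} {m j : ℕ} (h : ω' ∈ cyl (pre ω m)) (hj : j ≤ m) :
    preL ω' j = preL ω j := by
  unfold preL
  apply List.map_congr_left
  intro i hi
  exact h ⟨i, lt_of_lt_of_le (List.mem_range.1 hi) hj⟩

lemma disjoint_stopAt {𝒳 B : Type*} (φ : List 𝒳 → Option B) {m m' : ℕ} {y y' : B}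
    (h : (m, y) ≠ (m', y')) : Disjoint (stopAt φ m y) (stopAt φ m' y') := by
  rw [Set.disjoint_left]
  rintro ω ⟨h1, h2⟩ ⟨h3, h4⟩
  rcases lt_trichotomy m m' with hlt | rfl | hlt
  · simp [h4 m hlt] at h1
  · rw [h1] at h3
    exact h (by rw [Option.some.inj h3])
  · simp [h2 m' hlt] at h3

section Cylinders

variable {𝒳 : Type*} [MeasurableSpace 𝒳]

lemma measurable_pre (m : ℕ) : Measurable (fun ω : ℕ → 𝒳 => pre ω m) :=
  measurable_pi_lambda _ fun _ => measurable_pi_apply _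

lemma cylP_pre_antitone (μ : Measure (ℕ → 𝒳)) [IsProbabilityMeasure μ] (ω : ℕ → 𝒳) :
    Antitone (fun m => cylP μ (pre ω m)) := by
  intro m m' h
  refine ENNReal.toReal_mono (measure_ne_top _ _) (measure_mono ?_)
  intro ω' h' i
  exact h' (Fin.castLE h i)

lemma UpperTail.tsum_atypical_ne_top {μ : Measure (ℕ → 𝒳)} [IsProbabilityMeasure μ]
    (h : UpperTail μ) {δ : ℝ} (hδ : 0 < δ) :
    ∑' k, μ (atypical μ (specSup μ + δ) k) ≠ ∞ := by
  obtain ⟨K, m₀, hK⟩ := h δ hδ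
  have hs : Summable fun k => (μ (atypical μ (specSup μ + δ) k)).toReal := by
    have hb : Summable fun k : ℕ => K / (k : ℝ) ^ 2 := by
      simpa [div_eq_mul_inv] using
        (Real.summable_nat_pow_inv.2 (by norm_num : 1 < 2)).mul_left K
    refine hb.of_norm_bounded_eventually_nat ?_
    filter_upwards [eventually_ge_atTop m₀] with k hk
    rw [Real.norm_of_nonneg ENNReal.toReal_nonneg]
    exact hK k hk
  have := hs.tsum_ofReal_ne_top
  simpa [ENNReal.ofReal_toReal, measure_ne_top] using this

lemma specSup_nonneg (μ : Measure (ℕ → 𝒳)) [IsProbabilityMeasure μ] : 0 ≤ specSup μ := by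
  refine Real.sInf_nonneg fun lam hlam => ?_
  by_contra! hneg
  have h1 : ∀ m : ℕ, {ω | cylP μ (pre ω m) ≤ (2 : ℝ) ^ (-((m : ℝ) * lam))} = Set.univ := by
    intro m
    refine Set.eq_univ_of_forall fun ω => ?_
    have h2 : cylP μ (pre ω m) ≤ 1 := ENNReal.toReal_le_of_le_ofReal (by norm_num)
      (by simpa using prob_le_one)
    refine h2.trans (Real.one_le_rpow (by norm_num) ?_)
    have : (0 : ℝ) ≤ m := by positivity
    nlinarith
  simp only [Set.mem_ofPred_eq, h1, measure_univ, ENNReal.toReal_one] at hlam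
  exact zero_ne_one (tendsto_nhds_unique hlam tendsto_const_nhds)

/-- Atypicality at `m` persists, at a slightly lower level, for a positive fraction of `m`
further times. -/
lemma natCast_le_tsum_atypical (μ : Measure (ℕ → 𝒳)) [IsProbabilityMeasure μ] {H δ : ℝ}
    (hH : 0 ≤ H) (hδ : 0 < δ) {m : ℕ} {ω : ℕ → 𝒳} (hω : ω ∈ atypical μ (H + 2 * δ) m) :
    (m : ℝ≥0∞) ≤ ENNReal.ofReal ((H + δ) / δ) *
      ∑' k, (atypical μ (H + δ) k).indicator (fun _ => (1 : ℝ≥0∞)) ω := by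
  have hHδ : 0 < H + δ := by linarith
  set ρ : ℝ := (H + 2 * δ) / (H + δ) with hρ
  have hρ0 : 0 ≤ ρ := by positivity
  set M := ⌊ρ * m⌋₊
  have hmem : ∀ k ∈ Finset.Icc m M, ω ∈ atypical μ (H + δ) k := by
    intro k hk
    rw [Finset.mem_Icc] at hk
    refine (cylP_pre_antitone μ ω hk.1).trans (le_trans hω ?_)
    apply Real.rpow_le_rpow_of_exponent_le (by norm_num)
    have h1 : (k : ℝ) ≤ ρ * m := (Nat.cast_le.2 hk.2).trans (Nat.floor_le (by positivity))
    have h2 : (k : ℝ) * (H + δ) ≤ ρ * m * (H + δ) := by gcongr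
    have h3 : ρ * m * (H + δ) = m * (H + 2 * δ) := by rw [hρ]; field_simp
    linarith
  have hcard : (m : ℝ) ≤ (H + δ) / δ * ((Finset.Icc m M).card : ℝ) := by
    have h1 : ρ * m < M + 1 := Nat.lt_floor_add_one _
    have h2 : (M + 1 : ℝ) - m ≤ ((Finset.Icc m M).card : ℝ) := by
      rw [Nat.card_Icc, sub_le_iff_le_add]
      exact_mod_cast (by omega : M + 1 ≤ M + 1 - m + m)
    have h3 : (m : ℝ) = (H + δ) / δ * (ρ * m - m) := by rw [hρ]; field_simp; ring
    calc (m : ℝ) = (H + δ) / δ * (ρ * m - m) := h3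
      _ ≤ _ := by gcongr; linarith
  calc (m : ℝ≥0∞) = ENNReal.ofReal m := by simp
    _ ≤ ENNReal.ofReal ((H + δ) / δ * ((Finset.Icc m M).card : ℝ)) := ENNReal.ofReal_le_ofReal hcard
    _ = ENNReal.ofReal ((H + δ) / δ) * ((Finset.Icc m M).card : ℝ≥0∞) := by
        rw [ENNReal.ofReal_mul (by positivity)]; simp
    _ = ENNReal.ofReal ((H + δ) / δ) * ∑ k ∈ Finset.Icc m M,
          (atypical μ (H + δ) k).indicator (fun _ => (1 : ℝ≥0∞)) ω := by
        rw [Finset.sum_congr rfl fun k hk => Set.indicator_of_mem (hmem k hk) _]; simp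
    _ ≤ _ := by gcongr; exact ENNReal.sum_le_tsum _

end Cylinders

section Coin

variable {𝒳 : Type*} [Fintype 𝒳] [MeasurableSpace 𝒳] [DiscreteMeasurableSpace 𝒳]

lemma measurableSet_pre (m : ℕ) (s : Set (Fin m → 𝒳)) :
    MeasurableSet {ω : ℕ → 𝒳 | pre ω m ∈ s} :=
  measurable_pre m (MeasurableSet.of_discrete)

lemma measurableSet_preL (m : ℕ) (s : Set (List 𝒳)) :
    MeasurableSet {ω : ℕ → 𝒳 | preL ω m ∈ s} := by
  simp_rw [preL_eq_ofFn]
  exact measurableSet_pre m {x | List.ofFn x ∈ s}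

lemma measurableSet_stopAt {B : Type*} (φ : List 𝒳 → Option B) (m : ℕ) (y : B) :
    MeasurableSet (stopAt φ m y) := by
  have : stopAt φ m y = {ω | preL ω m ∈ {l | φ l = some y}} ∩
      ⋂ j, ⋂ _ : j < m, {ω | preL ω j ∈ {l | φ l = none}} := by
    ext ω; simp [stopAt]
  rw [this]
  exact (measurableSet_preL _ _).inter
    (MeasurableSet.iInter fun j => MeasurableSet.iInter fun _ => measurableSet_preL _ _)

lemma measurableSet_atypical (μ : Measure (ℕ → 𝒳)) (lam : ℝ) (m : ℕ) :
    MeasurableSet (atypical μ lam m) :=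
  measurableSet_pre m {x | cylP μ x ≤ (2 : ℝ) ^ (-((m : ℝ) * lam))}

/-- A multiple of the likelihood ratio of the uniform code with respect to `μ`; it bounds the excess
of the ideal code length over the uniform code length `m * log₂ (2 * |𝒳|)`. -/
def excess (μ : Measure (ℕ → 𝒳)) (m : ℕ) (ω : ℕ → 𝒳) : ℝ≥0∞ :=
  2 * ((2 * Fintype.card 𝒳 : ℝ≥0∞) ^ m)⁻¹ / μ (cyl (pre ω m))

lemma measurable_excess (μ : Measure (ℕ → 𝒳)) (m : ℕ) : Measurable (excess μ m) :=
  (Measurable.of_discrete (f := fun x : Fin m → 𝒳 =>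
    2 * ((2 * Fintype.card 𝒳 : ℝ≥0∞) ^ m)⁻¹ / μ (cyl x))).comp (measurable_pre m)

lemma lintegral_excess_le (μ : Measure (ℕ → 𝒳)) [Nonempty 𝒳] (m : ℕ) :
    ∫⁻ ω, excess μ m ω ∂μ ≤ 2 * 2⁻¹ ^ m := by
  have hc : (Fintype.card 𝒳 : ℝ≥0∞) ≠ 0 := by simp
  have h1 : ∫⁻ ω, excess μ m ω ∂μ = ∫⁻ x : Fin m → 𝒳,
      2 * ((2 * Fintype.card 𝒳 : ℝ≥0∞) ^ m)⁻¹ / μ (cyl x) ∂(μ.map fun ω => pre ω m) := by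
    rw [lintegral_map Measurable.of_discrete (measurable_pre m)]
    rfl
  rw [h1, lintegral_fintype]
  calc _ ≤ ∑ x : Fin m → 𝒳, 2 * ((2 * Fintype.card 𝒳 : ℝ≥0∞) ^ m)⁻¹ := by
        refine Finset.sum_le_sum fun x _ => ?_
        rw [Measure.map_apply (measurable_pre m) (measurableSet_singleton x)]
        have : (fun ω => pre ω m) ⁻¹' {x} = cyl x := by
          ext ω; simp [cyl, pre, funext_iff]
        rw [this]
        rw [mul_comm]
        exact ENNReal.mul_div_le
    _ = 2 * 2⁻¹ ^ m := by
        rw [Finset.sum_const, Finset.card_univ, Fintype.card_fun, Fintype.card_fin, nsmul_eq_mul,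
          Nat.cast_pow, mul_pow, ENNReal.mul_inv (by simp) (by simp), mul_left_comm,
          mul_left_comm _ _ (_⁻¹), ENNReal.mul_inv_cancel (pow_ne_zero _ hc) (by finiteness),
          mul_one, ENNReal.inv_pow]

end Coin

lemma logb_one_div_le {p q : ℝ} (hp : 0 < p) (hq : 0 < q) :
    Real.logb 2 (1 / p) ≤ Real.logb 2 (1 / q) + 2 * q / p := by
  have h1 : Real.logb 2 (1 / p) = Real.logb 2 (1 / q) + Real.logb 2 (q / p) := by
    rw [← Real.logb_mul (by positivity) (by positivity)]
    congr 1; field_simp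
  have h2 : Real.logb 2 (q / p) ≤ 2 * (q / p) := by
    have hl : 1 / 2 < Real.log 2 := by linarith [Real.log_two_gt_d9]
    rw [Real.logb, div_le_iff₀ (by linarith)]
    have h3 := Real.log_le_sub_one_of_pos (div_pos hq hp)
    have h4 : 0 < q / p := div_pos hq hp
    nlinarith
  rw [h1, mul_div_assoc]
  linarith

/-- Pointwise bound on the code length of the output of a valid algorithm. -/
lemma Valid.ofReal_logb_le {𝒳 B : Type*} [Fintype 𝒳] [MeasurableSpace 𝒳]
    (μ : Measure (ℕ → 𝒳)) [IsProbabilityMeasure μ]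
    [Nonempty 𝒳] {PY : B → ℝ} {φ : List 𝒳 → Option B} (hφ : Valid μ PY φ) {H δ : ℝ}
    (hH : 0 ≤ H) (hδ : 0 < δ) {m : ℕ} {y : B} {ω : ℕ → 𝒳} (hω : ω ∈ stopAt φ m y) :
    ENNReal.ofReal (Real.logb 2 (1 / PY y)) ≤
      ENNReal.ofReal (H + 2 * δ) * m +
        (ENNReal.ofReal (Real.logb 2 (2 * Fintype.card 𝒳)) * (ENNReal.ofReal ((H + δ) / δ) *
          ∑' k, (atypical μ (H + δ) k).indicator (fun _ => (1 : ℝ≥0∞)) ω) + excess μ m ω) := by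
  have hcard : (1 : ℝ) ≤ Fintype.card 𝒳 := by exact_mod_cast Fintype.card_pos
  have hcardE : (Fintype.card 𝒳 : ℝ≥0∞) ≠ 0 := by simp
  rcases eq_or_ne (μ (cyl (pre ω m))) 0 with h0 | h0
  · have : excess μ m ω = ∞ := by
      rw [excess, h0, ENNReal.div_zero]
      simp [ENNReal.mul_eq_top]
    simp [this]
  set p := cylP μ (pre ω m)
  have hp0 : 0 < p := ENNReal.toReal_pos h0 (measure_ne_top _ _)
  have hpE : μ (cyl (pre ω m)) = ENNReal.ofReal p := (ENNReal.ofReal_toReal (measure_ne_top _ _)).symm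
  have hpy : p ≤ PY y := by
    rw [← hφ y]
    refine ENNReal.toReal_mono (measure_ne_top _ _) (measure_mono ?_)
    intro ω' h'
    refine ⟨m, ?_, fun j hj => ?_⟩
    · rw [preL_congr h' le_rfl]; exact hω.1
    · rw [preL_congr h' hj.le]; exact hω.2 j hj
  have hlog : Real.logb 2 (1 / PY y) ≤ Real.logb 2 (1 / p) :=
    Real.logb_le_logb_of_le (by norm_num) (one_div_pos.2 (hp0.trans_le hpy))
      (one_div_le_one_div_of_le hp0 hpy)
  by_cases hbad : ω ∈ atypical μ (H + 2 * δ) m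
  · have hN := natCast_le_tsum_atypical μ hH hδ hbad
    refine le_trans ?_ le_add_self
    set q : ℝ := ((2 * Fintype.card 𝒳 : ℝ) ^ m)⁻¹ with hq
    have hq0 : 0 < q := by positivity
    have h1 : Real.logb 2 (1 / q) = Real.logb 2 (2 * Fintype.card 𝒳) * m := by
      rw [hq, one_div, inv_inv, Real.logb_pow, mul_comm]
    have hex : excess μ m ω = ENNReal.ofReal (2 * q / p) := by
      rw [excess, hpE, ENNReal.ofReal_div_of_pos hp0, ENNReal.ofReal_mul (by norm_num), hq,
        ENNReal.ofReal_inv_of_pos (by positivity), ENNReal.ofReal_pow (by positivity),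
        ENNReal.ofReal_mul (by norm_num)]
      simp
    have hc0 : 0 ≤ Real.logb 2 (2 * Fintype.card 𝒳) :=
      Real.logb_nonneg (by norm_num) (by linarith)
    calc ENNReal.ofReal (Real.logb 2 (1 / PY y))
        ≤ ENNReal.ofReal (Real.logb 2 (2 * Fintype.card 𝒳) * m + 2 * q / p) := by
          apply ENNReal.ofReal_le_ofReal
          rw [← h1]
          exact hlog.trans (logb_one_div_le hp0 hq0)
      _ = ENNReal.ofReal (Real.logb 2 (2 * Fintype.card 𝒳)) * m + excess μ m ω := by
          rw [ENNReal.ofReal_add (by positivity) (by positivity), ENNReal.ofReal_mul hc0, hex]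
          simp
      _ ≤ _ := by gcongr
  · refine le_trans ?_ le_self_add
    have h2 : (2 : ℝ) ^ (-((m : ℝ) * (H + 2 * δ))) < p := not_le.1 hbad
    rw [← ENNReal.ofReal_natCast, ← ENNReal.ofReal_mul (by positivity)]
    apply ENNReal.ofReal_le_ofReal
    refine hlog.trans ?_
    rw [one_div, Real.logb_inv, neg_le]
    have := (Real.lt_logb_iff_rpow_lt (by norm_num : (1 : ℝ) < 2) hp0).2 h2
    linarith

section Converse

variable {𝒳 : Type*} [Fintype 𝒳] [MeasurableSpace 𝒳] [DiscreteMeasurableSpace 𝒳]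

/-- `E[T] ≤ ∑ₘ Pr(T > m)` in terms of stopping events. -/
lemma tsum_mul_stopAt_le {B : Type*} [Finite B] (μ : Measure (ℕ → 𝒳)) (φ : List 𝒳 → Option B) :
    ∑' m : ℕ, (m : ℝ≥0∞) * μ (⋃ y, stopAt φ m y) ≤
      ∑' m : ℕ, μ {ω | ∀ i ≤ m, φ (preL ω i) = none} := by
  have hE : ∀ m, MeasurableSet (⋃ y, stopAt φ m y) := fun m =>
    MeasurableSet.iUnion fun y => measurableSet_stopAt φ m y
  have hd : Pairwise (Function.onFun Disjoint fun m => ⋃ y, stopAt φ m y) := by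
    intro m m' h
    simp only [Function.onFun, Set.disjoint_iUnion_left, Set.disjoint_iUnion_right]
    intro y y'
    exact disjoint_stopAt φ (by simp [h])
  calc ∑' m : ℕ, (m : ℝ≥0∞) * μ (⋃ y, stopAt φ m y)
      = ∑' m : ℕ, ∑' j : ℕ, if j < m then μ (⋃ y, stopAt φ m y) else 0 := by
        refine tsum_congr fun m => ?_
        rw [tsum_eq_sum (s := Finset.range m) (fun j hj => if_neg (by simpa using hj)),
          Finset.sum_congr rfl fun j hj => if_pos (Finset.mem_range.1 hj)]
        simp
    _ = ∑' j : ℕ, ∑' m : ℕ, if j < m then μ (⋃ y, stopAt φ m y) else 0 := ENNReal.tsum_comm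
    _ ≤ _ := by
        refine ENNReal.tsum_le_tsum fun j => ?_
        have : ∀ m, (if j < m then μ (⋃ y, stopAt φ m y) else 0) =
            μ ((⋃ y, stopAt φ m y) ∩ {ω | j < m}) := by
          intro m; by_cases h : j < m <;> simp [h]
        simp_rw [this]
        rw [← measure_iUnion]
        · refine measure_mono ?_
          intro ω hω
          simp only [Set.mem_iUnion, Set.mem_inter_iff, Set.mem_ofPred_eq] at hω
          obtain ⟨m, ⟨y, hy⟩, hj⟩ := hω
          exact fun i hi => hy.2 i (hi.trans_lt hj)
        · exact fun m m' h => (hd h).mono Set.inter_subset_left Set.inter_subset_left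
        · exact fun m => (hE m).inter (MeasurableSet.const _)

/-- The output entropy is at most `H̄ + 2δ` times the mean stopping time, up to a constant that
depends on the coin process only. -/
lemma UpperTail.entropy_le {μ : Measure (ℕ → 𝒳)} [IsProbabilityMeasure μ] (hUT : UpperTail μ)
    (hH : 0 ≤ specSup μ) {δ : ℝ} (hδ : 0 < δ) :
    ∃ C : ℝ≥0∞, C ≠ ∞ ∧ ∀ (B : Type _) [Fintype B] (PY : B → ℝ) (φ : List 𝒳 → Option B),
      Valid μ PY φ →
      ENNReal.ofReal (∑ y, PY y * Real.logb 2 (1 / PY y)) ≤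
        ENNReal.ofReal (specSup μ + 2 * δ) *
          ∑' m : ℕ, μ {ω | ∀ i ≤ m, φ (preL ω i) = none} + C := by
  have : Nonempty 𝒳 := by
    obtain ⟨ω⟩ := μ.nonempty_of_neZero
    exact ⟨ω 0⟩
  set H := specSup μ
  set c := ENNReal.ofReal (Real.logb 2 (2 * Fintype.card 𝒳))
  set a := ENNReal.ofReal ((H + δ) / δ)
  set N : (ℕ → 𝒳) → ℝ≥0∞ := fun ω =>
    c * (a * ∑' k, (atypical μ (H + δ) k).indicator (fun _ => (1 : ℝ≥0∞)) ω) with hN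
  have hind : ∀ k, Measurable ((atypical μ (H + δ) k).indicator (fun _ => (1 : ℝ≥0∞))) := fun k =>
    measurable_const.indicator (measurableSet_atypical μ _ k)
  have hNmeas : Measurable N :=
    ((Measurable.tsum hind).const_mul a).const_mul c
  have hNint : ∫⁻ ω, N ω ∂μ ≠ ∞ := by
    rw [hN, lintegral_const_mul _ ((Measurable.tsum hind).const_mul a),
      lintegral_const_mul _ (Measurable.tsum hind),
      lintegral_tsum fun k => (hind k).aemeasurable]
    simp_rw [lintegral_indicator_const (measurableSet_atypical μ _ _), one_mul]
    exact ENNReal.mul_ne_top ENNReal.ofReal_ne_top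
      (ENNReal.mul_ne_top ENNReal.ofReal_ne_top (hUT.tsum_atypical_ne_top hδ))
  have hex : ∑' m, ∫⁻ ω, excess μ m ω ∂μ ≠ ∞ := by
    refine ne_top_of_le_ne_top ?_ (ENNReal.tsum_le_tsum fun m => lintegral_excess_le μ m)
    rw [ENNReal.tsum_mul_left, ENNReal.tsum_geometric]
    simp [ENNReal.mul_eq_top]
  refine ⟨∫⁻ ω, N ω ∂μ + ∑' m, ∫⁻ ω, excess μ m ω ∂μ, ENNReal.add_ne_top.2 ⟨hNint, hex⟩, ?_⟩
  intro B _ PY φ hφ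
  have hms := measurableSet_stopAt φ
  have hdy : ∀ m, Pairwise (Function.onFun Disjoint fun y => stopAt φ m y) := fun m y y' h =>
    disjoint_stopAt φ (by simp [h])
  have hdm : Pairwise (Function.onFun Disjoint fun m => ⋃ y, stopAt φ m y) := by
    intro m m' h
    simp only [Function.onFun, Set.disjoint_iUnion_left, Set.disjoint_iUnion_right]
    intro y y'
    exact disjoint_stopAt φ (by simp [h])
  have hE : ∀ m, MeasurableSet (⋃ y, stopAt φ m y) := fun m =>
    MeasurableSet.iUnion fun y => hms m y
  have hPY : ∀ y, ENNReal.ofReal (PY y) = ∑' m, μ (stopAt φ m y) := by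
    intro y
    rw [← hφ y, ENNReal.ofReal_toReal (measure_ne_top _ _),
      ← measure_iUnion (fun m m' h => disjoint_stopAt φ (by simp [h])) (fun m => hms m y)]
    congr 1
    ext ω
    simp [stopAt]
  have hPY0 : ∀ y, 0 ≤ PY y := fun y => by rw [← hφ y]; exact ENNReal.toReal_nonneg
  set h : B → ℝ≥0∞ := fun y => ENNReal.ofReal (Real.logb 2 (1 / PY y))
  calc ENNReal.ofReal (∑ y, PY y * Real.logb 2 (1 / PY y))
      ≤ ∑ y, ENNReal.ofReal (PY y * Real.logb 2 (1 / PY y)) := by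
        exact Finset.le_sum_of_subadditive _ ENNReal.ofReal_zero.le
          (fun _ _ => ENNReal.ofReal_add_le) _ _
    _ = ∑ y, ∑' m, μ (stopAt φ m y) * h y := by
        refine Finset.sum_congr rfl fun y _ => ?_
        rw [ENNReal.ofReal_mul (hPY0 y), hPY, ENNReal.tsum_mul_right]
    _ = ∑' m, ∑' y, ∫⁻ _ in stopAt φ m y, h y ∂μ := by
        rw [← tsum_fintype (L := .unconditional B), ENNReal.tsum_comm]
        simp [mul_comm]
    _ ≤ ∑' m : ℕ, ∑' y, ∫⁻ ω in stopAt φ m y,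
          (ENNReal.ofReal (H + 2 * δ) * m + (N ω + excess μ m ω)) ∂μ := by
        refine ENNReal.tsum_le_tsum fun m => ENNReal.tsum_le_tsum fun y => ?_
        exact setLIntegral_mono' (hms m y) fun ω hω => hφ.ofReal_logb_le μ hH hδ hω
    _ = ∑' m : ℕ, ∫⁻ ω in ⋃ y, stopAt φ m y,
          (ENNReal.ofReal (H + 2 * δ) * m + (N ω + excess μ m ω)) ∂μ := by
        refine tsum_congr fun m => ?_
        rw [lintegral_iUnion (fun y => hms m y) (hdy m)]
    _ = ∑' m : ℕ, (ENNReal.ofReal (H + 2 * δ) * (m * μ (⋃ y, stopAt φ m y)) +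
          (∫⁻ ω in ⋃ y, stopAt φ m y, N ω ∂μ +
            ∫⁻ ω in ⋃ y, stopAt φ m y, excess μ m ω ∂μ)) := by
        refine tsum_congr fun m => ?_
        rw [lintegral_add_left measurable_const, lintegral_add_left hNmeas, setLIntegral_const,
          mul_assoc]
    _ ≤ ENNReal.ofReal (H + 2 * δ) * ∑' m : ℕ, μ {ω | ∀ i ≤ m, φ (preL ω i) = none} +
          (∫⁻ ω, N ω ∂μ + ∑' m, ∫⁻ ω, excess μ m ω ∂μ) := by
        rw [ENNReal.tsum_add, ENNReal.tsum_add, ENNReal.tsum_mul_left,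
          ← lintegral_iUnion hE hdm]
        refine add_le_add (mul_le_mul_right (tsum_mul_stopAt_le μ φ) _)
          (add_le_add (setLIntegral_le_lintegral _ _)
            (ENNReal.tsum_le_tsum fun m => setLIntegral_le_lintegral _ _))

end Converse

end RNG

open RNG
/-- **Theorem 4, converse part.** If the coin process `μ` satisfies the upper-tail
condition, then for any target process `ν` the infimum average achievable rate over all
valid algorithms satisfies `L⋆(X,Y) ≥ H(Y)/H̄(X)`. -/
theorem Lstar_ge_ratio
    {𝒳 𝒴 : Type*} [Fintype 𝒳] [MeasurableSpace 𝒳] [DiscreteMeasurableSpace 𝒳]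
    [Fintype 𝒴] [MeasurableSpace 𝒴] [DiscreteMeasurableSpace 𝒴]
    (μ : Measure (ℕ → 𝒳)) [IsProbabilityMeasure μ]
    (ν : Measure (ℕ → 𝒴)) [IsProbabilityMeasure ν]
    (hUT : UpperTail μ) :
    ENNReal.ofReal (entRate ν / specSup μ) ≤ Lstar μ ν := by
  have hH := specSup_nonneg μ
  rcases hH.eq_or_lt with h0 | hpos
  · simp [← h0]
  refine le_sInf fun L hL => ?_
  obtain ⟨φ, hvalid, hlim⟩ := hL
  rcases eq_or_ne L ∞ with rfl | hLtop
  · exact le_top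
  lift L to NNReal using hLtop
  have key : ∀ ε : ℝ, 0 < ε →
      entRate ν ≤ (specSup μ + 2 * ε) * (L + ε) + ε := by
    intro ε hε
    obtain ⟨C, hC, hent⟩ := hUT.entropy_le hH hε
    lift C to NNReal using hC
    have hev : ∀ᶠ n : ℕ in atTop, (∑' m : ℕ, μ {ω | ∀ i ≤ m, φ n (preL ω i) = none}) /
        (n : ℝ≥0∞) < ENNReal.ofReal (L + ε) := by
      refine eventually_lt_of_limsup_lt (hlim.trans_lt ?_)
      rw [← ENNReal.ofReal_coe_nnreal]
      exact (ENNReal.ofReal_lt_ofReal_iff (by positivity)).2 (by linarith)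
    have hCn : ∀ᶠ n : ℕ in atTop, (C : ℝ) / n < ε :=
      (tendsto_const_div_atTop_nhds_zero_nat (C : ℝ)).eventually_lt_const hε
    refine limsup_le_of_le (isCoboundedUnder_le_of_le atTop (x := 0) fun n => ?_) ?_
    · refine div_nonneg (Finset.sum_nonneg fun y _ => ?_) (by positivity)
      have h1 : cylP ν y ≤ 1 := ENNReal.toReal_le_of_le_ofReal (by norm_num)
        (by simpa using prob_le_one)
      have h2 : 0 ≤ cylP ν y := ENNReal.toReal_nonneg
      refine mul_nonneg h2 ?_
      rw [one_div, Real.logb_inv, neg_nonneg]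
      exact Real.logb_nonpos (by norm_num) h2 h1
    · filter_upwards [hev, hCn, eventually_gt_atTop 0] with n hn hCn hn0
      have hn0' : (0 : ℝ) < n := by exact_mod_cast hn0
      have h1 : ∑' m : ℕ, μ {ω | ∀ i ≤ m, φ n (preL ω i) = none} ≤
          ENNReal.ofReal ((L + ε) * n) := by
        rw [ENNReal.ofReal_mul (by positivity), ENNReal.ofReal_natCast]
        exact (ENNReal.div_le_iff (by simp; omega) (by simp)).1 hn.le
      have h2 := (hent (Fin n → 𝒴) _ (φ n) (hvalid n)).trans
        (add_le_add_left (mul_le_mul_right h1 _) _)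
      rw [← ENNReal.ofReal_mul (by positivity), ← ENNReal.ofReal_coe_nnreal (p := C),
        ← ENNReal.ofReal_add (by positivity) (by positivity),
        ENNReal.ofReal_le_ofReal_iff (by positivity)] at h2
      rw [div_le_iff₀ hn0']
      rw [div_lt_iff₀ hn0'] at hCn
      linarith
  have hle : entRate ν ≤ specSup μ * L := by
    have ht : Tendsto (fun ε : ℝ => (specSup μ + 2 * ε) * (L + ε) + ε) (nhdsWithin 0 (Set.Ioi 0))
        (nhds ((specSup μ + 2 * 0) * (L + 0) + 0)) :=
      Tendsto.mono_left (Continuous.tendsto (by fun_prop) 0) nhdsWithin_le_nhds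
    have := ge_of_tendsto ht (eventually_mem_nhdsWithin.mono fun ε hε => key ε hε)
    simpa using this
  rw [← ENNReal.ofReal_coe_nnreal]
  apply ENNReal.ofReal_le_ofReal
  rw [div_le_iff₀ hpos]
  linarith
end
end

section
/- Let X = {X^m} be a Markov chain on a finite set 𝒳 induced by an irreducible transition matrix W with arbitrary initial distribution P_{X_1}. Then the spectral inf-entropy, the entropy rate, and the spectral sup-entropy all coincide with H^W(X): H_(X) = H(X) = H̄(X) = H^W(X). Moreover, the upper-tail and lower-tail conditions hold: for any δ > 0 there exist K, m_0 such that Pr((1/m)log(1/P_{X^m}(X^m)) ≥ H^W(X)+δ) ≤ K/m² and Pr((1/m)log(1/P_{X^m}(X^m)) ≤ H^W(X)−δ) ≤ K/m² for all m ≥ m_0. -/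
open MeasureTheory Filter
open scoped ENNReal Classical

noncomputable section

open RNG

namespace RNG

section MarkovLemmas

variable {𝒳 : Type*}

/-- The sum of `D` over the transitions of a path with `n` steps. -/
def pathSum (D : 𝒳 → 𝒳 → ℝ) (n : ℕ) (x : Fin (n + 1) → 𝒳) : ℝ :=
  ∑ i : Fin n, D (x i.castSucc) (x i.succ)

lemma pathSum_snoc (D : 𝒳 → 𝒳 → ℝ) (n : ℕ) (x : Fin (n + 1) → 𝒳) (y : 𝒳) :
    pathSum D (n + 1) (Fin.snoc x y : Fin (n + 2) → 𝒳)
      = pathSum D n x + D (x (Fin.last n)) y := by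
  unfold pathSum
  rw [Fin.sum_univ_castSucc]
  simp only [Fin.snoc_castSucc, Fin.succ_last, Fin.snoc_last, ← Fin.castSucc_succ]

lemma markovP_snoc (q : 𝒳 → ℝ) (W : 𝒳 → 𝒳 → ℝ) (n : ℕ) (x : Fin (n + 1) → 𝒳) (y : 𝒳) :
    markovP q W (n + 2) (Fin.snoc x y : Fin (n + 2) → 𝒳)
      = markovP q W (n + 1) x * W (x (Fin.last n)) y := by
  have h0 : (Fin.snoc x y : Fin (n + 2) → 𝒳) 0 = x 0 := by
    rw [← Fin.castSucc_zero, Fin.snoc_castSucc]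
  simp only [markovP]
  rw [Fin.prod_univ_castSucc, h0, mul_assoc]
  simp only [Fin.snoc_castSucc, Fin.succ_last, Fin.snoc_last, ← Fin.castSucc_succ]

lemma pathSum_sub_sub (h : 𝒳 → ℝ) (n : ℕ) (x : Fin (n + 1) → 𝒳) :
    pathSum (fun a b => h a - h b) n x = h (x 0) - h (x (Fin.last n)) := by
  induction n with
  | zero => simp [pathSum]
  | succ n ih =>
    have := pathSum_snoc (fun a b => h a - h b) n (Fin.init x) (x (Fin.last _))
    rw [Fin.snoc_init_self, ih] at this
    rw [this]
    simp [Fin.init]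

variable [Fintype 𝒳]

lemma sum_fin_succ_eq_sum_snoc (n : ℕ) (F : (Fin (n + 1) → 𝒳) → ℝ) :
    ∑ x, F x = ∑ x : Fin n → 𝒳, ∑ y : 𝒳, F (Fin.snoc x y : Fin (n + 1) → 𝒳) := by
  rw [← (Fin.snocEquiv (fun _ : Fin (n + 1) => 𝒳)).sum_comp, Fintype.sum_prod_type_right]
  rfl

lemma markovP_nonneg {q : 𝒳 → ℝ} {W : 𝒳 → 𝒳 → ℝ} (hq : IsInitial q) (hW : IsTransMat W)
    (m : ℕ) (x : Fin m → 𝒳) : 0 ≤ markovP q W m x := by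
  cases m with
  | zero => simp [markovP]
  | succ m => exact mul_nonneg (hq.1 _) (Finset.prod_nonneg fun i _ => hW.1 _ _)

lemma sum_markovP {q : 𝒳 → ℝ} {W : 𝒳 → 𝒳 → ℝ} (hq : IsInitial q) (hW : IsTransMat W)
    (n : ℕ) : ∑ x, markovP q W (n + 1) x = 1 := by
  induction n with
  | zero =>
    rw [sum_fin_succ_eq_sum_snoc]
    simp [markovP, Fin.snoc, hq.2]
  | succ n ih =>
    rw [sum_fin_succ_eq_sum_snoc]
    simp_rw [markovP_snoc, ← Finset.mul_sum, hW.2, mul_one, ih]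

/-- The martingale `pathSum D` has mean zero. -/
lemma sum_markovP_mul_pathSum {q : 𝒳 → ℝ} {W : 𝒳 → 𝒳 → ℝ} (hW : IsTransMat W)
    {D : 𝒳 → 𝒳 → ℝ} (hD : ∀ a, ∑ b, W a b * D a b = 0) (n : ℕ) :
    ∑ x, markovP q W (n + 1) x * pathSum D n x = 0 := by
  induction n with
  | zero => simp [pathSum]
  | succ n ih =>
    rw [sum_fin_succ_eq_sum_snoc, ← ih]
    refine Finset.sum_congr rfl fun x _ => ?_
    simp_rw [markovP_snoc, pathSum_snoc, mul_add, Finset.sum_add_distrib, mul_assoc]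
    rw [← Finset.mul_sum, ← Finset.mul_sum, hD, ← Finset.sum_mul, hW.2]
    ring

lemma sum_mul_exp_le {W : 𝒳 → 𝒳 → ℝ} (hW : IsTransMat W)
    {D : 𝒳 → 𝒳 → ℝ} (hD : ∀ a, ∑ b, W a b * D a b = 0) {c s : ℝ}
    (hc : ∀ a b, |D a b| ≤ c) (hs : 0 ≤ s) (hsc : s * c ≤ 1) (a : 𝒳) :
    ∑ b, W a b * Real.exp (s * D a b) ≤ Real.exp (s ^ 2 * c ^ 2) := by
  have hpt : ∀ b, Real.exp (s * D a b) ≤ 1 + s * D a b + s ^ 2 * c ^ 2 := by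
    intro b
    have hb : |s * D a b| ≤ s * c := by
      rw [abs_mul, abs_of_nonneg hs]
      exact mul_le_mul_of_nonneg_left (hc a b) hs
    have h1 := (abs_le.mp (Real.abs_exp_sub_one_sub_id_le (hb.trans hsc))).2
    have h2 : (s * D a b) ^ 2 ≤ (s * c) ^ 2 := sq_le_sq' (by linarith [abs_le.mp hb]) (abs_le.mp hb).2
    rw [mul_pow s c] at h2
    linarith
  calc ∑ b, W a b * Real.exp (s * D a b)
      ≤ ∑ b, W a b * (1 + s * D a b + s ^ 2 * c ^ 2) :=
        Finset.sum_le_sum fun b _ => mul_le_mul_of_nonneg_left (hpt b) (hW.1 _ _)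
    _ = (∑ b, W a b) * (1 + s ^ 2 * c ^ 2) + s * ∑ b, W a b * D a b := by
        rw [Finset.sum_mul, Finset.mul_sum, ← Finset.sum_add_distrib]
        exact Finset.sum_congr rfl fun b _ => by ring
    _ = s ^ 2 * c ^ 2 + 1 := by rw [hW.2, hD]; ring
    _ ≤ _ := Real.add_one_le_exp _

lemma sum_markovP_mul_exp_pathSum_le {q : 𝒳 → ℝ} {W : 𝒳 → 𝒳 → ℝ} (hq : IsInitial q)
    (hW : IsTransMat W) {D : 𝒳 → 𝒳 → ℝ} (hD : ∀ a, ∑ b, W a b * D a b = 0) {c s : ℝ}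
    (hc : ∀ a b, |D a b| ≤ c) (hs : 0 ≤ s) (hsc : s * c ≤ 1) (n : ℕ) :
    ∑ x, markovP q W (n + 1) x * Real.exp (s * pathSum D n x)
      ≤ Real.exp (n * (s ^ 2 * c ^ 2)) := by
  induction n with
  | zero => simp [pathSum, sum_markovP hq hW 0]
  | succ n ih =>
    rw [sum_fin_succ_eq_sum_snoc]
    calc _ = ∑ x : Fin (n + 1) → 𝒳, markovP q W (n + 1) x * Real.exp (s * pathSum D n x)
          * ∑ b, W (x (Fin.last n)) b * Real.exp (s * D (x (Fin.last n)) b) := by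
          refine Finset.sum_congr rfl fun x _ => ?_
          rw [Finset.mul_sum]
          refine Finset.sum_congr rfl fun b _ => ?_
          rw [markovP_snoc, pathSum_snoc, mul_add, Real.exp_add]
          ring
      _ ≤ ∑ x : Fin (n + 1) → 𝒳, markovP q W (n + 1) x * Real.exp (s * pathSum D n x)
          * Real.exp (s ^ 2 * c ^ 2) :=
          Finset.sum_le_sum fun x _ => mul_le_mul_of_nonneg_left
            (sum_mul_exp_le hW hD hc hs hsc _)
            (mul_nonneg (markovP_nonneg hq hW _ _) (Real.exp_pos _).le)
      _ ≤ Real.exp (n * (s ^ 2 * c ^ 2)) * Real.exp (s ^ 2 * c ^ 2) := by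
          rw [← Finset.sum_mul]
          exact mul_le_mul_of_nonneg_right ih (Real.exp_pos _).le
      _ = _ := by
          rw [← Real.exp_add]
          push_cast
          ring_nf

/-- Chernoff bound for an additive functional of a Markov chain with centred increments. -/
lemma sum_markovP_ite_le {q : 𝒳 → ℝ} {W : 𝒳 → 𝒳 → ℝ} (hq : IsInitial q)
    (hW : IsTransMat W) {D : 𝒳 → 𝒳 → ℝ} (hD : ∀ a, ∑ b, W a b * D a b = 0)
    (B : ℝ) {δ : ℝ} (hδ : 0 < δ) :
    ∃ K : ℝ, 0 ≤ K ∧ ∀ (n : ℕ) (A : (Fin (n + 1) → 𝒳) → Prop),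
      (∀ x, A x → 0 < markovP q W (n + 1) x → (n + 1 : ℝ) * δ - B ≤ pathSum D n x) →
      ∑ x, (if A x then markovP q W (n + 1) x else 0) ≤ K / (n + 1 : ℝ) ^ 2 := by
  obtain ⟨c, hc1, hc⟩ : ∃ c : ℝ, 1 ≤ c ∧ ∀ a b, |D a b| ≤ c := by
    obtain ⟨c, hc⟩ := (Set.finite_range fun z : 𝒳 × 𝒳 => |D z.1 z.2|).bddAbove
    exact ⟨max 1 c, le_max_left _ _, fun a b => (hc ⟨(a, b), rfl⟩).trans (le_max_right _ _)⟩
  set s : ℝ := min (1 / c) (δ / (2 * c ^ 2)) with hs_def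
  have hcpos : 0 < c := by linarith
  have hs : 0 < s := lt_min (by positivity) (by positivity)
  have hsc : s * c ≤ 1 := by
    have : s ≤ 1 / c := min_le_left _ _
    rwa [le_div_iff₀ hcpos] at this
  have hsδ : s * c ^ 2 ≤ δ / 2 := by
    have : s ≤ δ / (2 * c ^ 2) := min_le_right _ _
    rw [le_div_iff₀ (by positivity)] at this
    linarith
  set κ : ℝ := s * δ / 2 with hκ_def
  have hκ : 0 < κ := by positivity
  refine ⟨Real.exp (s * B) * (2 / κ ^ 2), by positivity, fun n A hA => ?_⟩
  have hn : (0 : ℝ) < n + 1 := by positivity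
  have hquad : Real.exp (-(κ * (n + 1))) ≤ 2 / (κ ^ 2 * (n + 1 : ℝ) ^ 2) := by
    have h := Real.quadratic_le_exp_of_nonneg (show 0 ≤ κ * (n + 1 : ℝ) by positivity)
    have h' : κ ^ 2 * (n + 1 : ℝ) ^ 2 / 2 ≤ Real.exp (κ * (n + 1)) := by
      have : 0 ≤ κ * (n + 1 : ℝ) := by positivity
      nlinarith
    rw [Real.exp_neg, ← one_div, div_le_div_iff₀ (Real.exp_pos _) (by positivity)]
    linarith
  calc ∑ x, (if A x then markovP q W (n + 1) x else 0)
      ≤ ∑ x, markovP q W (n + 1) x * Real.exp (s * pathSum D n x)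
          * Real.exp (-(s * ((n + 1) * δ - B))) := by
        refine Finset.sum_le_sum fun x _ => ?_
        have h0 := markovP_nonneg hq hW (n + 1) x
        split_ifs with hx
        · rcases h0.eq_or_lt with h | h
          · rw [← h]; simp
          · rw [mul_assoc, ← Real.exp_add]
            refine le_mul_of_one_le_right h0 (Real.one_le_exp ?_)
            have := mul_le_mul_of_nonneg_left (hA x hx h) hs.le
            linarith
        · positivity
    _ ≤ Real.exp (n * (s ^ 2 * c ^ 2)) * Real.exp (-(s * ((n + 1) * δ - B))) := by
        rw [← Finset.sum_mul]
        exact mul_le_mul_of_nonneg_right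
          (sum_markovP_mul_exp_pathSum_le hq hW hD hc hs.le hsc n) (Real.exp_pos _).le
    _ ≤ Real.exp (s * B) * Real.exp (-(κ * (n + 1))) := by
        rw [← Real.exp_add, ← Real.exp_add]
        refine Real.exp_le_exp.mpr ?_
        have h1 : s ^ 2 * c ^ 2 ≤ κ := by
          have := mul_le_mul_of_nonneg_left hsδ hs.le
          rw [hκ_def]; nlinarith
        have h2 : (n : ℝ) * (s ^ 2 * c ^ 2) ≤ n * κ :=
          mul_le_mul_of_nonneg_left h1 (Nat.cast_nonneg n)
        have h3 : s * δ = 2 * κ := by rw [hκ_def]; ring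
        have h4 : s * ((n + 1) * δ - B) = 2 * κ * (n + 1) - s * B := by rw [← h3]; ring
        rw [h4]
        nlinarith
    _ ≤ Real.exp (s * B) * (2 / (κ ^ 2 * (n + 1 : ℝ) ^ 2)) :=
        mul_le_mul_of_nonneg_left hquad (Real.exp_pos _).le
    _ = _ := by
        rw [mul_div_assoc, div_div]

section Poisson

variable [DecidableEq 𝒳] {W : Matrix 𝒳 𝒳 ℝ}

/-- A harmonic function of an irreducible transition matrix is constant. -/
lemma eq_of_mulVec_eq_self (hW : IsTransMat W) (hirr : IrreducibleMat W) {h : 𝒳 → ℝ}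
    (hh : W.mulVec h = h) (x y : 𝒳) : h x = h y := by
  have hpow : ∀ k : ℕ, (∀ a b, 0 ≤ (W ^ k) a b) ∧ (∀ a, ∑ b, (W ^ k) a b = 1)
      ∧ (W ^ k).mulVec h = h := by
    intro k
    induction k with
    | zero =>
      refine ⟨fun a b => ?_, fun a => ?_, by simp⟩
      · rw [pow_zero, Matrix.one_apply]; split_ifs <;> norm_num
      · simp [Matrix.one_apply]
    | succ k ih =>
      refine ⟨fun a b => ?_, fun a => ?_, ?_⟩
      · rw [pow_succ, Matrix.mul_apply]
        exact Finset.sum_nonneg fun j _ => mul_nonneg (ih.1 _ _) (hW.1 _ _)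
      · simp_rw [pow_succ, Matrix.mul_apply]
        rw [Finset.sum_comm]
        simp_rw [← Finset.mul_sum, hW.2, mul_one, ih.2.1]
      · rw [pow_succ, ← Matrix.mulVec_mulVec, hh, ih.2.2]
  have : Nonempty 𝒳 := ⟨x⟩
  obtain ⟨z, hz⟩ := Finite.exists_max h
  have key : ∀ y, h y = h z := by
    intro y
    obtain ⟨k, -, hk⟩ := hirr z y
    obtain ⟨h0, h1, h2⟩ := hpow k
    have hsum : ∑ b, (W ^ k) z b * (h z - h b) = 0 := by
      have := congrFun h2 z
      simp only [Matrix.mulVec, dotProduct] at this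
      simp_rw [mul_sub, Finset.sum_sub_distrib, ← Finset.sum_mul, h1, this]
      ring
    have := (Finset.sum_eq_zero_iff_of_nonneg fun b _ =>
      mul_nonneg (h0 z b) (sub_nonneg.mpr (hz b))).mp hsum y (Finset.mem_univ _)
    rcases mul_eq_zero.mp this with h' | h'
    · exact absurd h' hk.ne'
    · linarith
  rw [key x, key y]

/-- Solvability of the Poisson equation of an irreducible transition matrix. -/
lemma exists_poisson (hW : IsTransMat W) (hirr : IrreducibleMat W) {π : 𝒳 → ℝ}
    (hπ : IsStationary π W) (g : 𝒳 → ℝ) :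
    ∃ h : 𝒳 → ℝ, ∀ a, h a - ∑ b, W a b * h b = g a - ∑ b, π b * g b := by
  let T : (𝒳 → ℝ) →ₗ[ℝ] (𝒳 → ℝ) := (1 - W).mulVecLin
  let φ : (𝒳 → ℝ) →ₗ[ℝ] ℝ := Fintype.linearCombination ℝ π
  have hφ : ∀ v, φ v = ∑ b, π b * v b := fun v => by
    simp [φ, Fintype.linearCombination_apply, mul_comm]
  have hT : ∀ v a, T v a = v a - ∑ b, W a b * v b := fun v a => by
    simp [T, Matrix.mulVec, dotProduct]
  have hle : LinearMap.range T ≤ LinearMap.ker φ := by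
    rintro _ ⟨v, rfl⟩
    rw [LinearMap.mem_ker, hφ]
    simp_rw [hT, mul_sub, Finset.sum_sub_distrib, Finset.mul_sum]
    rw [Finset.sum_comm]
    simp_rw [← mul_assoc, ← Finset.sum_mul, hπ.2.2, sub_self]
  have hker : LinearMap.ker T ≤ Submodule.span ℝ {fun _ => (1 : ℝ)} := by
    intro v hv
    rw [LinearMap.mem_ker] at hv
    have hv' : W.mulVec v = v := by
      ext a
      have := congrFun hv a
      rw [hT] at this
      simp only [Pi.zero_apply] at this
      simp only [Matrix.mulVec, dotProduct]
      linarith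
    rw [Submodule.mem_span_singleton]
    by_cases hne : Nonempty 𝒳
    · obtain ⟨z⟩ := hne
      exact ⟨v z, funext fun a => by simp [eq_of_mulVec_eq_self hW hirr hv' z a]⟩
    · exact ⟨0, funext fun a => absurd ⟨a⟩ hne⟩
  have h1 : Module.finrank ℝ (LinearMap.ker T) ≤ 1 :=
    (Submodule.finrank_mono hker).trans ((finrank_span_le_card _).trans (by simp))
  have h2 := LinearMap.finrank_range_add_finrank_ker T
  have h3 := LinearMap.finrank_range_add_finrank_ker φ
  have h4 : 1 ≤ Module.finrank ℝ (LinearMap.range φ) := by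
    rw [Nat.one_le_iff_ne_zero, Ne, Submodule.finrank_eq_zero, LinearMap.range_eq_bot]
    intro h0
    have := hφ (fun _ => 1)
    rw [h0] at this
    simp [hπ.2.1] at this
  have heq : LinearMap.range T = LinearMap.ker φ :=
    Submodule.eq_of_le_of_finrank_le hle (by omega)
  have hmem : (fun a => g a - ∑ b, π b * g b) ∈ LinearMap.ker φ := by
    rw [LinearMap.mem_ker, hφ]
    simp_rw [mul_sub, Finset.sum_sub_distrib, ← Finset.sum_mul, hπ.2.1]
    ring
  rw [← heq] at hmem
  obtain ⟨v, hv⟩ := hmem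
  exact ⟨v, fun a => by rw [← hT, hv]⟩

/-- Martingale approximation of the self-information of a Markov chain. -/
lemma exists_martingale_approx (hW : IsTransMat W) (hirr : IrreducibleMat W) {π : 𝒳 → ℝ}
    (hπ : IsStationary π W) (q : 𝒳 → ℝ) :
    ∃ (D : 𝒳 → 𝒳 → ℝ) (B : ℝ), (∀ a, ∑ b, W a b * D a b = 0) ∧
      ∀ (n : ℕ) (x : Fin (n + 1) → 𝒳), markovP q W (n + 1) x ≠ 0 →
        |-Real.logb 2 (markovP q W (n + 1) x) - (n + 1) * matEnt π W - pathSum D n x| ≤ B := by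
  let f : 𝒳 → 𝒳 → ℝ := fun a b => -Real.logb 2 (W a b)
  let g : 𝒳 → ℝ := fun a => ∑ b, W a b * f a b
  have hH : ∑ a, π a * g a = matEnt π W := by
    simp only [matEnt, g, f, Finset.mul_sum, one_div, Real.logb_inv, mul_assoc]
  obtain ⟨h, hh⟩ := exists_poisson hW hirr hπ g
  rw [hH] at hh
  set H := matEnt π W
  let D : 𝒳 → 𝒳 → ℝ := fun a b => f a b - H - (h a - h b)
  obtain ⟨C, hC⟩ := (Set.finite_range fun a : 𝒳 => |h a| + |Real.logb 2 (q a)|).bddAbove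
  have hC' : ∀ a, |h a| + |Real.logb 2 (q a)| ≤ C := fun a => hC ⟨a, rfl⟩
  refine ⟨D, 2 * C + |H|, fun a => ?_, fun n x hx => ?_⟩
  · have h1 : ∑ b, W a b * D a b
        = g a - (∑ b, W a b) * (H + h a) + ∑ b, W a b * h b := by
      simp only [g, D]
      rw [Finset.sum_mul, ← Finset.sum_sub_distrib, ← Finset.sum_add_distrib]
      exact Finset.sum_congr rfl fun b _ => by ring
    rw [h1, hW.2]
    linarith [hh a]
  · have hq : q (x 0) ≠ 0 := left_ne_zero_of_mul hx
    have hprod := right_ne_zero_of_mul hx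
    have hlog : -Real.logb 2 (markovP q W (n + 1) x)
        = -Real.logb 2 (q (x 0)) + pathSum f n x := by
      simp only [markovP, pathSum, f]
      rw [Real.logb_mul hq hprod, Real.logb_prod _ _ fun i hi =>
        Finset.prod_ne_zero_iff.mp hprod i hi, Finset.sum_neg_distrib]
      ring
    have hsum : pathSum D n x = pathSum f n x - n * H - (h (x 0) - h (x (Fin.last n))) := by
      rw [← pathSum_sub_sub]
      simp [pathSum, D, Finset.sum_sub_distrib]
    rw [hlog, hsum]
    have e : -Real.logb 2 (q (x 0)) + pathSum f n x - (n + 1) * H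
        - (pathSum f n x - n * H - (h (x 0) - h (x (Fin.last n))))
        = -Real.logb 2 (q (x 0)) - H + h (x 0) - h (x (Fin.last n)) := by ring
    rw [e]
    have a1 := hC' (x 0)
    have a2 := hC' (x (Fin.last n))
    have b0 := abs_le.mp (le_refl |Real.logb 2 (q (x 0))|)
    have b1 := abs_le.mp (le_refl |h (x 0)|)
    have b2 := abs_le.mp (le_refl |h (x (Fin.last n))|)
    have b3 := abs_le.mp (le_refl |H|)
    have b4 := abs_nonneg (Real.logb 2 (q (x (Fin.last n))))
    rw [abs_le]
    constructor <;> linarith [b0.1, b0.2, b1.1, b1.2, b2.1, b2.2, b3.1, b3.2]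

end Poisson

lemma toReal_measure_pre [MeasurableSpace 𝒳] [DiscreteMeasurableSpace 𝒳]
    (μ : Measure (ℕ → 𝒳)) [IsProbabilityMeasure μ] (m : ℕ) (A : (Fin m → 𝒳) → Prop) :
    (μ {ω | A (pre ω m)}).toReal = ∑ x, if A x then cylP μ x else 0 := by
  have hmeas : Measurable (fun ω : ℕ → 𝒳 => pre ω m) :=
    measurable_pi_lambda _ fun i => measurable_pi_apply _
  have hcyl : ∀ x : Fin m → 𝒳,
      cylP μ x = μ.real ((fun ω : ℕ → 𝒳 => pre ω m) ⁻¹' {x}) := by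
    intro x
    rw [cylP, Measure.real]
    congr 2
    ext ω
    simp [pre, funext_iff]
  have hset : {ω : ℕ → 𝒳 | A (pre ω m)}
      = (fun ω : ℕ → 𝒳 => pre ω m) ⁻¹' (Finset.univ.filter A : Finset (Fin m → 𝒳)) := by
    ext ω; simp
  rw [← Finset.sum_filter, hset]
  simp_rw [hcyl]
  exact (sum_measureReal_preimage_singleton _
    fun y _ => hmeas (measurableSet_singleton y)).symm

end MarkovLemmas

section Spectrum

variable {𝒳 : Type*} [MeasurableSpace 𝒳]

/-- An upper-tail probability at `a` and a lower-tail probability at some `b > a` cannot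
both vanish. -/
lemma le_of_tendsto_tails (μ : Measure (ℕ → 𝒳)) [IsProbabilityMeasure μ] {a b : ℝ}
    (ha : Tendsto (fun m : ℕ =>
      (μ {ω | cylP μ (pre ω m) ≤ (2 : ℝ) ^ (-((m : ℝ) * a))}).toReal) atTop (nhds 0))
    (hb : Tendsto (fun m : ℕ =>
      (μ {ω | (2 : ℝ) ^ (-((m : ℝ) * b)) ≤ cylP μ (pre ω m)}).toReal) atTop (nhds 0)) :
    b ≤ a := by
  by_contra! hab
  have hadd := ha.add hb
  rw [add_zero] at hadd
  obtain ⟨m, hm⟩ := (hadd.eventually (gt_mem_nhds one_pos)).exists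
  have hcov : {ω | cylP μ (pre ω m) ≤ (2 : ℝ) ^ (-((m : ℝ) * a))}
      ∪ {ω | (2 : ℝ) ^ (-((m : ℝ) * b)) ≤ cylP μ (pre ω m)} = Set.univ := by
    refine Set.eq_univ_of_forall fun ω => ?_
    rcases le_total (cylP μ (pre ω m)) ((2 : ℝ) ^ (-((m : ℝ) * a))) with h | h
    · exact Or.inl h
    · refine Or.inr (le_trans ?_ h)
      refine Real.rpow_le_rpow_of_exponent_le one_le_two ?_
      have := mul_le_mul_of_nonneg_left hab.le (Nat.cast_nonneg (α := ℝ) m)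
      linarith
  have h1 := measureReal_union_le (μ := μ)
    {ω | cylP μ (pre ω m) ≤ (2 : ℝ) ^ (-((m : ℝ) * a))}
    {ω | (2 : ℝ) ^ (-((m : ℝ) * b)) ≤ cylP μ (pre ω m)}
  rw [hcov, probReal_univ] at h1
  simp only [Measure.real] at h1
  linarith

/-- If both tails at distance `δ` from `H` vanish for all `δ > 0`, then the spectrum is `H`. -/
lemma specInf_specSup_eq (μ : Measure (ℕ → 𝒳)) [IsProbabilityMeasure μ] {H : ℝ}
    (hup : ∀ δ : ℝ, 0 < δ → Tendsto (fun m : ℕ =>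
      (μ {ω | cylP μ (pre ω m) ≤ (2 : ℝ) ^ (-((m : ℝ) * (H + δ)))}).toReal) atTop (nhds 0))
    (hlo : ∀ δ : ℝ, 0 < δ → Tendsto (fun m : ℕ =>
      (μ {ω | (2 : ℝ) ^ (-((m : ℝ) * (H - δ))) ≤ cylP μ (pre ω m)}).toReal) atTop (nhds 0)) :
    specInf μ = H ∧ specSup μ = H := by
  constructor
  · refine csSup_eq_of_forall_le_of_forall_lt_exists_gt ⟨H - 1, hlo 1 one_pos⟩ ?_ ?_
    · intro b hb
      exact le_of_forall_pos_le_add fun ε hε => le_of_tendsto_tails μ (hup ε hε) hb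
    · intro w hw
      exact ⟨H - (H - w) / 2, hlo _ (by linarith), by linarith⟩
  · refine csInf_eq_of_forall_ge_of_forall_gt_exists_lt ⟨H + 1, hup 1 one_pos⟩ ?_ ?_
    · intro a ha
      refine le_of_forall_pos_le_add fun ε hε => ?_
      linarith [le_of_tendsto_tails μ ha (hlo ε hε)]
    · intro w hw
      exact ⟨H + (w - H) / 2, hup _ (by linarith), by linarith⟩

end Spectrum

end RNG

/-- **Irreducible Markov coin.** For a Markov chain `μ` induced by an irreducible
transition matrix `W` with stationary distribution `π` and arbitrary initial distribution
`p`, the spectral inf-entropy, the entropy rate, and the spectral sup-entropy all coincide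
with `H^W(X)`, and the upper- and lower-tail conditions hold with `H^W(X)` in place of
`H̄(X)` and `H̲(X)`. -/
theorem irreducible_markov_one_point_spectrum
    {𝒳 : Type*} [Fintype 𝒳] [DecidableEq 𝒳] [MeasurableSpace 𝒳] [DiscreteMeasurableSpace 𝒳]
    (W : Matrix 𝒳 𝒳 ℝ) (hW : IsTransMat W) (hWirr : IrreducibleMat W)
    (π : 𝒳 → ℝ) (hπ : IsStationary π W)
    (p : 𝒳 → ℝ) (hp : IsInitial p)
    (μ : Measure (ℕ → 𝒳)) [IsProbabilityMeasure μ] (hμ : IsMarkovMeasure μ p W) :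
    specInf μ = matEnt π W ∧ entRate μ = matEnt π W ∧ specSup μ = matEnt π W
    ∧ ∀ δ : ℝ, 0 < δ → ∃ (K : ℝ) (m₀ : ℕ), ∀ m : ℕ, m₀ ≤ m →
        (μ {ω | cylP μ (pre ω m) ≤ (2 : ℝ) ^ (-((m : ℝ) * (matEnt π W + δ)))}).toReal
            ≤ K / (m : ℝ) ^ 2
        ∧ (μ {ω | (2 : ℝ) ^ (-((m : ℝ) * (matEnt π W - δ))) ≤ cylP μ (pre ω m)}).toReal
            ≤ K / (m : ℝ) ^ 2 := by
  obtain ⟨D, B, hD, hB⟩ := exists_martingale_approx hW hWirr hπ p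
  set H := matEnt π W with hH
  have tails : ∀ δ : ℝ, 0 < δ → ∃ (K : ℝ) (m₀ : ℕ), ∀ m : ℕ, m₀ ≤ m →
      (μ {ω | cylP μ (pre ω m) ≤ (2 : ℝ) ^ (-((m : ℝ) * (H + δ)))}).toReal
          ≤ K / (m : ℝ) ^ 2
      ∧ (μ {ω | (2 : ℝ) ^ (-((m : ℝ) * (H - δ))) ≤ cylP μ (pre ω m)}).toReal
          ≤ K / (m : ℝ) ^ 2 := by
    intro δ hδ
    have hD' : ∀ a, ∑ b, W a b * (fun a b => -D a b) a b = 0 := fun a => by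
      simp [Finset.sum_neg_distrib, hD a]
    obtain ⟨K₁, hK₁, h₁⟩ := sum_markovP_ite_le hp hW hD B hδ
    obtain ⟨K₂, hK₂, h₂⟩ := sum_markovP_ite_le hp hW hD' B hδ
    refine ⟨K₁ + K₂, 1, fun m hm => ?_⟩
    obtain ⟨n, rfl⟩ : ∃ n, m = n + 1 := ⟨m - 1, by omega⟩
    rw [toReal_measure_pre μ (n + 1)
        (fun x => cylP μ x ≤ (2 : ℝ) ^ (-(((n + 1 : ℕ) : ℝ) * (H + δ)))),
      toReal_measure_pre μ (n + 1)
        (fun x => (2 : ℝ) ^ (-(((n + 1 : ℕ) : ℝ) * (H - δ))) ≤ cylP μ x)]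
    simp_rw [hμ (n + 1)]
    push_cast
    constructor
    · refine (h₁ n _ fun x hx hpos => ?_).trans (by gcongr; linarith)
      have hl := Real.logb_le_logb_of_le one_lt_two hpos hx
      rw [Real.logb_rpow two_pos (by norm_num)] at hl
      have := abs_le.mp (hB n x hpos.ne')
      linarith [this.2]
    · refine (h₂ n _ fun x hx hpos => ?_).trans (by gcongr; linarith)
      have hl := Real.logb_le_logb_of_le one_lt_two (Real.rpow_pos_of_pos two_pos _) hx
      rw [Real.logb_rpow two_pos (by norm_num)] at hl
      have := abs_le.mp (hB n x hpos.ne')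
      have hneg : pathSum (fun a b => -D a b) n x = -pathSum D n x := by
        simp [pathSum, Finset.sum_neg_distrib]
      rw [hneg]
      linarith [this.1]
  have hK0 : ∀ K : ℝ, Tendsto (fun m : ℕ => K / (m : ℝ) ^ 2) atTop (nhds 0) := fun K =>
    tendsto_const_nhds.div_atTop
      ((tendsto_pow_atTop two_ne_zero).comp tendsto_natCast_atTop_atTop)
  have hspec : specInf μ = H ∧ specSup μ = H := by
    refine specInf_specSup_eq μ (fun δ hδ => ?_) (fun δ hδ => ?_) <;>
      obtain ⟨K, m₀, h⟩ := tails δ hδ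
    · exact squeeze_zero' (Eventually.of_forall fun m => ENNReal.toReal_nonneg)
        (eventually_atTop.mpr ⟨m₀, fun m hm => (h m hm).1⟩) (hK0 K)
    · exact squeeze_zero' (Eventually.of_forall fun m => ENNReal.toReal_nonneg)
        (eventually_atTop.mpr ⟨m₀, fun m hm => (h m hm).2⟩) (hK0 K)
  refine ⟨hspec.1, ?_, hspec.2, tails⟩
  refine Tendsto.limsup_eq ?_
  rw [← tendsto_add_atTop_iff_nat 1]
  have hbound : ∀ n : ℕ, |(∑ x : Fin (n + 1) → 𝒳, cylP μ x * Real.logb 2 (1 / cylP μ x))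
      - (n + 1) * H| ≤ B := by
    intro n
    simp_rw [hμ (n + 1)]
    have hsum := sum_markovP hp hW n
    have e : (∑ x, markovP p W (n + 1) x * Real.logb 2 (1 / markovP p W (n + 1) x))
        - (n + 1) * H = ∑ x, markovP p W (n + 1) x *
          (-Real.logb 2 (markovP p W (n + 1) x) - (n + 1) * H - pathSum D n x) := by
      simp_rw [mul_sub, Finset.sum_sub_distrib, ← Finset.sum_mul, hsum,
        sum_markovP_mul_pathSum hW hD n, one_div, Real.logb_inv]
      ring
    rw [e]
    refine (Finset.abs_sum_le_sum_abs _ _).trans ?_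
    calc _ ≤ ∑ x, markovP p W (n + 1) x * B := by
          refine Finset.sum_le_sum fun x _ => ?_
          have h0 := markovP_nonneg hp hW (n + 1) x
          rw [abs_mul, abs_of_nonneg h0]
          rcases eq_or_ne (markovP p W (n + 1) x) 0 with h | h
          · simp [h]
          · exact mul_le_mul_of_nonneg_left (hB n x h) h0
      _ = B := by rw [← Finset.sum_mul, hsum, one_mul]
  have hlim : Tendsto (fun n : ℕ => B / ((n : ℝ) + 1)) atTop (nhds 0) :=
    tendsto_const_nhds.div_atTop
      (tendsto_atTop_add_const_right _ _ tendsto_natCast_atTop_atTop)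
  rw [tendsto_iff_dist_tendsto_zero]
  refine squeeze_zero (fun _ => dist_nonneg) (fun n => ?_) hlim
  have hn : (0 : ℝ) < n + 1 := by positivity
  rw [Real.dist_eq]
  push_cast
  rw [le_div_iff₀ hn, ← abs_of_pos hn, ← abs_mul, abs_of_pos hn, sub_mul, div_mul_cancel₀ _ hn.ne',
    mul_comm H]
  exact hbound n
end
end
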